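/- arXiv:2005.00538 — 3 statements merged into one kernel-verified Lean document; each statement's English description precedes it below -/
import Mathlib

section
/- Let R be a 3-torsion free alternative ring. Then R is a prime ring (i.e. for any two nonzero two-sided ideals A, B of R one has AB ≠ 0) if and only if the following holds: for all a, b ∈ R, if (a r) b = 0 for every r ∈ R, then a = 0 or b = 0. -/
set_option linter.unusedSimpArgs false


/-- A (two-sided) ideal of a not necessarily associative ring: an additive
subgroup closed under left and right multiplication by arbitrary ring elements. -/
def IsTwoSidedIdealSet {R : Type*} [NonUnitalNonAssocRing R] (I : AddSubgroup R) : Prop :=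
  ∀ r : R, ∀ x ∈ I, r * x ∈ I ∧ x * r ∈ I

namespace Alt
class AltR (R : Type*) [NonUnitalNonAssocRing R] : Prop where
  l : ∀ x y : R, x * x * y = x * (x * y)
  r : ∀ x y : R, y * x * x = y * (x * x)

variable {R : Type*} [NonUnitalNonAssocRing R]

/-- the associator -/
def A (x y z : R) : R := x * y * z - x * (y * z)

theorem A_def (x y z : R) : A x y z = x * y * z - x * (y * z) := rfl

theorem A_add1 (x x' y z : R) : A (x + x') y z = A x y z + A x' y z := by
  simp only [A, mul_add, add_mul]; abel
theorem A_add2 (x y y' z : R) : A x (y + y') z = A x y z + A x y' z := by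
  simp only [A, mul_add, add_mul]; abel
theorem A_add3 (x y z z' : R) : A x y (z + z') = A x y z + A x y z' := by
  simp only [A, mul_add]; abel
theorem A_sub1 (x x' y z : R) : A (x - x') y z = A x y z - A x' y z := by
  simp only [A, mul_sub, sub_mul]; abel
theorem A_sub2 (x y y' z : R) : A x (y - y') z = A x y z - A x y' z := by
  simp only [A, mul_sub, sub_mul]; abel
theorem A_sub3 (x y z z' : R) : A x y (z - z') = A x y z - A x y z' := by
  simp only [A, mul_sub]; abel
theorem A_neg1 (x y z : R) : A (-x) y z = - A x y z := by
  simp only [A, neg_mul]; abel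
theorem A_neg2 (x y z : R) : A x (-y) z = - A x y z := by
  simp only [A, neg_mul, mul_neg]; abel
theorem A_neg3 (x y z : R) : A x y (-z) = - A x y z := by
  simp only [A, mul_neg]; abel

/-- Teichmueller identity -/
theorem T (w x y z : R) : A (w * x) y z - A w (x * y) z + A w x (y * z)
    = w * A x y z + A w x y * z := by
  simp only [A, mul_sub, sub_mul]; abel

variable [AltR R]

theorem A_xxy (x y : R) : A x x y = 0 := by simp [A, AltR.l]
theorem A_yxx (x y : R) : A y x x = 0 := by simp [A, AltR.r]
theorem s12 (x y z : R) : A y x z = - A x y z := by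
  have h := A_xxy (x + y) z
  rw [A_add1, A_add2, A_add2, A_xxy, A_xxy] at h
  linear_combination (norm := abel) h
theorem s23 (x y z : R) : A x z y = - A x y z := by
  have h := A_yxx (y + z) x
  rw [A_add2, A_add3, A_add3, A_yxx, A_yxx] at h
  linear_combination (norm := abel) h
theorem s13 (x y z : R) : A z y x = - A x y z := by
  rw [s12, s23, s12]; simp
theorem cyc (x y z : R) : A y z x = A x y z := by rw [s23, s12]; simp

/-- Teichmueller identity with products in front -/
theorem T' (w x y z : R) : A (w * x) y z + A (x * y) w z + A (y * z) w x
    = w * A x y z + A w x y * z := by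
  have h := T w x y z
  rw [s12 (x * y) w z, cyc (y * z) w x] at h
  linear_combination (norm := abel) h

theorem I1 (x w y z : R) : A (x * w) y z = x * A w y z + A x y z * w - A (y * z - z * y) x w := by
  have h1 := T' x w y z
  have h2 := T' x w z y
  have h3 := T' x y w z
  have h4 := T' z x w y
  have h5 := T' z x y w
  rw [A_sub1]
  simp only [s12 x w, s12 x y, s12 x z, s12 w y, s12 w z, s12 y z, s23 _ x w, s23 _ x y, s23 _ x z,
    s23 _ w y, s23 _ w z, s23 _ y z, mul_neg, neg_mul, neg_neg] at *
  linear_combination (norm := abel) h1 - h2 + h3 + h4 + h5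

/-- two-sided orthogonality -/
structure Orth (a b : R) : Prop where
  ab : a * b = 0
  ba : b * a = 0
  arb : ∀ r, a * r * b = 0
  bra : ∀ r, b * r * a = 0
  a_rb : ∀ r, a * (r * b) = 0
  b_ra : ∀ r, b * (r * a) = 0

theorem Orth.symm {a b : R} (h : Orth a b) : Orth b a :=
  ⟨h.ba, h.ab, h.bra, h.arb, h.b_ra, h.a_rb⟩

theorem Orth.A0 {a b : R} (h : Orth a b) (r : R) : A a b r = 0 := by
  rw [s23, A_def, h.arb, h.a_rb]; simp
theorem Orth.A0' {a b : R} (h : Orth a b) (r : R) : A a r b = 0 := by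
  rw [A_def, h.arb, h.a_rb]; simp
theorem Orth.A0'' {a b : R} (h : Orth a b) (r : R) : A r a b = 0 := by
  rw [← cyc, h.A0]
theorem Orth.a_br {a b : R} (h : Orth a b) (r : R) : a * (b * r) = 0 := by
  have := h.A0 r
  rw [A_def, h.ab, zero_mul, zero_sub, neg_eq_zero] at this; exact this
theorem Orth.rab {a b : R} (h : Orth a b) (r : R) : r * a * b = 0 := by
  have := h.A0'' r
  rwa [A_def, h.ab, mul_zero, sub_zero] at this

theorem A_zero1 (y z : R) : A 0 y z = 0 := by simp [A]

section
variable {a b : R} (h : Orth a b)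
include h

theorem e1 (x y : R) : A (x * a) b y = A a x y * b := by
  have t := T' y x a b
  rw [h.A0'', h.A0'', h.ab, A_zero1, s23 (x * a) b y, cyc a y x, s23 a x y] at t
  simp only [mul_zero, add_zero, zero_add, neg_mul, neg_inj] at t
  exact t
theorem e2 (x y : R) : A (b * x) y a = A a x y * b := by
  have t := T' y a b x
  rw [h.A0, h.A0'', h.ab, A_zero1, s23 (y * a) b x |> fun _ => e1 h y x, s23 a x y] at t
  simp only [mul_zero, zero_mul, add_zero, zero_add, neg_mul] at t
  linear_combination (norm := abel) t
theorem e3 (x y : R) : a * A b x y = - (A a x y * b) := by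
  have t := T' a b x y
  rw [h.A0, h.A0'', h.ab, A_zero1, s23 (b * x) y a, e2 h] at t
  simp only [mul_zero, zero_mul, add_zero, zero_add] at t
  exact t.symm
theorem der (x y z : R) : A a (x * y) z * b = x * (A a y z * b) + (A a x z * b) * y := by
  have k : ∀ t, A t (z * a) b = - (A a t z * b) := by
    intro t
    rw [← cyc t, e1 h, s23 a t z, neg_mul]
  have t := I1 x y (z * a) b
  rw [h.rab, h.b_ra, sub_zero, A_zero1, k, k, k] at t
  simp only [mul_neg, neg_mul] at t
  linear_combination (norm := abel) - t
theorem azxy (x y z : R) : A (a * z) x y * b = (A a x y * z) * b + A a (x * y - y * x) z * b := by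
  rw [I1 a z x y, sub_mul, add_mul, h.arb, ← cyc _ a z, s23 a (x * y - y * x) z]
  simp
theorem zaxy (x y z : R) : A (z * a) x y * b = (z * A a x y) * b - A a (x * y - y * x) z * b := by
  rw [I1 z a x y, sub_mul, add_mul, h.rab, cyc a _ z]
  simp
theorem Wcyc (x y z : R) : (A a x y * z) * b - z * (A a x y * b)
    = (A a y z * x) * b - x * (A a y z * b) := by
  have t := congrArg (· * b) (T a x y z)
  simp only [add_mul, sub_mul, h.arb, azxy h, A_sub2] at t
  rw [s23 a (y*z) x, neg_mul, der h x y z, der h y z x, der h z y x] at t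
  simp only [s23 a x y, s23 a x z, s23 a y z, neg_mul, mul_neg] at t ⊢
  linear_combination (norm := abel) -t
theorem Jac (x y z : R) : x * (A a y z * b) - (A a y z * b) * x + (y * (A a z x * b) - (A a z x * b) * y)
   + (z * (A a x y * b) - (A a x y * b) * z) = 0 := by
  have t := congrArg (· * b) (T z a x y)
  have w := Wcyc h x z y
  simp only [add_mul, sub_mul] at t
  rw [zaxy h, s12 (a * x) z y, neg_mul, azxy h, ← cyc z a (x * y), ← cyc z a x] at t
  simp only [A_sub2, sub_mul, der h] at t
  simp only [s23 a x y, s23 a x z, s23 a y z, neg_mul, mul_neg] at t w ⊢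
  linear_combination (norm := abel) -t - w
end

theorem star (q : R → R → R) (D : ∀ x y z, q (x * y) z = x * q y z + q x z * y)
    (D2 : ∀ x y z, q z (x * y) = x * q z y + q z x * y) (x y z w : R) :
    (x * z - z * x) * q y w - q x z * (y * w - w * y) =
      2 • (A (q x z) y w + A (q y w) x z) - (A (q x w) y z + A (q y z) x w) := by
  have g : ∀ x z u v, x * (z * q u v) = x * z * q u v - A (q u v) x z := by
    intro x z u v; rw [← cyc (q u v) x z, A_def]; abel
  have m : ∀ x z u v, x * (q u v * z) = x * q u v * z + A (q u v) x z := by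
    intro x z u v; rw [s12 x, A_def]; abel
  have r : ∀ x z u v, q u v * x * z = q u v * (x * z) + A (q u v) x z := by
    intro x z u v; rw [A_def]; abel
  have h : x * q y (z * w) + q x (z * w) * y = z * q (x * y) w + q (x * y) z * w := by
    rw [← D, ← D2]
  simp only [D, D2, mul_add, add_mul, g, m, r] at h
  simp only [mul_sub, sub_mul]
  rw [s23 _ x z, s23 _ y w, s23 _ y z] at h
  linear_combination (norm := abel) h

theorem nucq (q : R → R → R) (sw : ∀ x y, q y x = - q x y)
    (D : ∀ x y z, q (x * y) z = x * q y z + q x z * y)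
    (S : ∀ x y z, x * q y z - q y z * x + (y * q z x - q z x * y) + (z * q x y - q x y * z) = 0)
    (x y z w : R) : 3 • A (q y w) x z = 0 := by
  have D2 : ∀ x y z, q z (x * y) = x * q z y + q z x * y := by
    intro x y z
    rw [sw (x * y) z, D, sw z y, sw z x, mul_neg, neg_mul]; abel
  have g : ∀ x z u v, x * (z * q u v) = x * z * q u v - A (q u v) x z := by
    intro x z u v; rw [← cyc (q u v) x z, A_def]; abel
  have m : ∀ x z u v, x * (q u v * z) = x * q u v * z + A (q u v) x z := by
    intro x z u v; rw [s12 x, A_def]; abel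
  have r : ∀ x z u v, q u v * x * z = q u v * (x * z) + A (q u v) x z := by
    intro x z u v; rw [A_def]; abel
  have h := S (x * z) y w
  have h1 := congrArg (x * ·) (S z y w)
  have h2 := congrArg (· * z) (S x y w)
  have k1 := star q D D2 x z y w
  have k2 := star q D D2 x z w y
  simp only [D, D2, mul_add, add_mul, mul_sub, sub_mul, g, m, r, mul_zero, zero_mul, sw y w, sw x w, sw z w, sw x y, sw z y, A_neg1, 
    sw x z, mul_neg, neg_mul, s23 _ x y, s23 _ x z, s23 _ x w, s23 _ y z, s23 _ w z, s23 _ w y] at h h1 h2 k1 k2 ⊢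
  linear_combination (norm := abel) h - h1 - h2 - k1 + k2

theorem nuc (tor3 : ∀ x : R, (3 : ℕ) • x = 0 → x = 0) {a b : R} (h : Orth a b) (x y z w : R) :
    A (A a x y * b) z w = 0 := by
  apply tor3
  exact nucq (fun x y => A a x y * b) (fun x y => by simp only [s23 a x y, neg_mul]) (der h) (Jac h)
    z x w y

/-! Moufang identities -/
theorem Axy (x y z : R) : A (x * y) x z = - (A x y z * x) := by
  have t := T' x x y z
  have i := I1 x x y z
  rw [A_yxx] at i
  rw [A_xxy, A_yxx] at t
  simp only [zero_mul, add_zero, sub_zero, neg_zero] at t i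
  linear_combination (norm := abel) t - i
theorem Ayx (x y z : R) : A (y * x) x z = - (x * A x y z) := by
  have t := T' y x x z
  have i := I1 x x y z
  have j := Axy x z y
  rw [A_sub1, A_yxx, A_yxx] at i
  rw [A_xxy, A_yxx, s23 (x * z) x y, j, s23 x y z] at t
  simp only [zero_mul, mul_zero, neg_mul, add_zero, sub_zero, neg_neg] at t i
  linear_combination (norm := abel) t - i
theorem flex (x y : R) : x * y * x = x * (y * x) := by
  have : A x y x = 0 := by rw [← cyc, A_yxx]
  exact sub_eq_zero.1 this
theorem M1 (x y z : R) : x * y * x * z = x * (y * (x * z)) := by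
  have t := T x y x z
  have e : A x y x = 0 := by rw [← cyc, A_yxx]
  rw [s12 (y * x), Ayx, s12 x y z, e] at t
  simp only [mul_neg, neg_neg, zero_mul, add_zero, A_def (x * y), A_def x y (x * z)] at t
  linear_combination (norm := abel) t
theorem M2 (x y z : R) : z * x * y * x = z * (x * (y * x)) := by
  have e1 := Ayx x z y
  have e2 := Ayx x y z
  rw [s23 _ y x] at e1
  rw [s23 _ z x, ← cyc (y * x) z x] at e2
  rw [s23 x y z, mul_neg] at e1
  simp only [A_def (z * x), A_def z x] at e1 e2
  linear_combination (norm := abel) -e1-e2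
theorem M3 (x y z : R) : x * y * (z * x) = x * (y * z * x) := by
  have e := Ayx x z y
  rw [← cyc (z * x) x y, s23 x y z, ← cyc x y z] at e
  simp only [A_def, mul_neg, neg_neg, mul_sub] at e
  linear_combination (norm := abel) e
theorem M2l (x y z w : R) : z * x * y * w + z * w * y * x = z * (x * (y * w)) + z * (w * (y * x)) := by
  have := M2 (x + w) y z
  simp only [mul_add, add_mul] at this
  rw [M2, M2] at this
  linear_combination (norm := abel) this
theorem M1l (x y z w : R) : x * y * w * z + w * y * x * z = x * (y * (w * z)) + w * (y * (x * z)) := by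
  have := M1 (x + w) y z
  simp only [mul_add, add_mul] at this
  rw [M1, M1] at this
  linear_combination (norm := abel) this

theorem U1 (x y s : R) : x * y * s * (x * y) = x * (y * s) * x * y := by
  have h := M2l y s x (x * y)
  have f : y * (s * (x * y)) + x * y * (s * y) = y * s * (x * y) + x * y * s * y := by
    have h1 : A y s (x * y) = - A (x * y) s y := s13 _ _ _
    simp only [A_def] at h1
    linear_combination (norm := abel) -h1
  rw [← mul_add, f, mul_add, M2, ← AltR.l, ← AltR.l, M2] at h
  rw [M1]
  linear_combination (norm := abel) h
theorem U2 (x y s : R) : x * y * (s * (x * y)) = x * (y * (s * x * y)) := by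
  have h := M1l x s y (x * y)
  have f : x * s * (x * y) + x * y * s * x = x * (s * (x * y)) + x * y * (s * x) := by
    have h1 : A x s (x * y) = - A (x * y) s x := s13 _ _ _
    simp only [A_def] at h1
    linear_combination (norm := abel) h1
  rw [← add_mul, f, add_mul, ← M1, AltR.r, AltR.r, M1, M2] at h
  linear_combination (norm := abel) -h

/-- totally degenerate elements -/
def T0 (a : R) : Prop := a * a = 0 ∧ ∀ r, a * r * a = 0

theorem T0.mulr {a : R} (h : T0 a) (x : R) : T0 (a * x) := by
  constructor
  · have e := Axy a x x
    rw [A_yxx, A_def, h.2] at e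
    simpa using e
  · intro r; rw [U1, h.2, zero_mul]
theorem T0.mull {a : R} (h : T0 a) (x : R) : T0 (x * a) := by
  constructor
  · have e := Ayx a x x
    have e' : A x a (x * a) = 0 := by
      rw [cyc (x * a) x a, s23 _ a x, e, A_yxx]; simp
    rw [A_def, ← flex, h.2] at e'
    simpa using e'
  · intro r; rw [flex, U2, ← flex, h.2, mul_zero]
theorem T0.neg {a : R} (h : T0 a) : T0 (-a) := by
  constructor
  · simp [h.1]
  · intro r; simp [h.2]

/-- primeness -/
def Prm (R : Type*) [NonUnitalNonAssocRing R] : Prop :=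
  ∀ A B : AddSubgroup R, IsTwoSidedIdealSet A → IsTwoSidedIdealSet B →
        (∃ a ∈ A, a ≠ 0) → (∃ b ∈ B, b ≠ 0) → ∃ a ∈ A, ∃ b ∈ B, a * b ≠ 0

theorem ann (P : Prm R) (B : AddSubgroup R) (hB : IsTwoSidedIdealSet B) (a : R)
    (ha : ∀ b ∈ B, a * b = 0) (b : R) (hb : b ∈ B) : a = 0 ∨ b = 0 := by
  by_contra! hc
  let C : AddSubgroup R :=
    { carrier := {c | ∀ b ∈ B, c * b = 0}
      zero_mem' := fun b _ => zero_mul b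
      add_mem' := fun {x y} hx hy b hb => by rw [add_mul, hx b hb, hy b hb, add_zero]
      neg_mem' := fun {x} hx b hb => by rw [neg_mul, hx b hb, neg_zero] }
  have hC : IsTwoSidedIdealSet C := by
    intro r x hx
    have key : ∀ b ∈ B, A x b r = 0 := fun b hb => by
      rw [A_def, hx b hb, hx _ (hB r b hb).2]; simp
    constructor
    · intro b hb
      have := key b hb
      rw [cyc, A_def, hx b hb] at this
      simpa using this
    · intro b hb
      have := key b hb
      rw [s23, A_def, hx _ (hB r b hb).1] at this
      simpa using this
  obtain ⟨x, hx, y, hy, hxy⟩ := P C B hC hB ⟨a, ha, hc.1⟩ ⟨b, hb, hc.2⟩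
  exact hxy (hx y hy)

theorem L2 (P : Prm R) (c : R) (hn : ∀ x y, A c x y = 0) (h : T0 c) : c = 0 := by
  have k : ∀ b r s, c * b = 0 → c * A b r s = 0 := by
    intro b r s hb
    have t := T c b r s
    rw [hb, A_zero1, hn, hn, hn] at t
    simpa using t.symm
  have q : ∀ x y, c * (x * y) = c * x * y := by
    intro x y
    have := hn x y
    rw [A_def, sub_eq_zero] at this; exact this.symm
  let B : AddSubgroup R :=
    { carrier := {b | c * b = 0 ∧ ∀ r, c * (r * b) = 0}
      zero_mem' := by simp
      add_mem' := fun {x y} hx hy => by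
        refine ⟨by rw [mul_add, hx.1, hy.1, add_zero], fun r => ?_⟩
        rw [mul_add, mul_add, hx.2, hy.2, add_zero]
      neg_mem' := fun {x} hx => by
        refine ⟨by rw [mul_neg, hx.1, neg_zero], fun r => ?_⟩
        rw [mul_neg, mul_neg, hx.2, neg_zero] }
  have hB : IsTwoSidedIdealSet B := by
    intro s b hb
    refine ⟨⟨hb.2 s, fun r => ?_⟩, ⟨?_, fun r => ?_⟩⟩
    · have e := k b r s hb.1
      rw [← cyc b r s, A_def, mul_sub, hb.2] at e
      simpa using e
    · rw [q, hb.1, zero_mul]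
    · have e := k b r s hb.1
      rw [s12, mul_neg, A_def, mul_sub, q (r * b), hb.2] at e
      simpa using e
  rcases ann P B hB c (fun b hb => hb.1) c ⟨h.1, fun r => by rw [q, h.2]⟩ with h | h <;> exact h

section
variable {a b : R} (h : Orth a b) (p : ∀ x y, A a x y * b = 0) (p' : ∀ x y, A b x y * a = 0)
include h p p'

theorem Orth.z1 (x y : R) : A (x * a) b y = 0 := by rw [e1 h, p]
theorem Orth.z2 (x y : R) : A (b * x) y a = 0 := by rw [e2 h, p]
theorem Orth.z3 (x y : R) : a * A b x y = 0 := by rw [e3 h, p, neg_zero]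
theorem Orth.z1' (x y : R) : A (x * b) a y = 0 := by rw [e1 h.symm, p']
theorem Orth.z2' (x y : R) : A (a * x) y b = 0 := by rw [e2 h.symm, p']
theorem Orth.z3' (x y : R) : b * A a x y = 0 := by rw [e3 h.symm, p', neg_zero]

theorem Orth.mulr (x : R) : Orth a (b * x) := by
  have k : ∀ r, b * x * (r * a) = 0 := by
    intro r
    have e : A b x (r * a) = 0 := by rw [cyc (r * a), h.z1 p p']
    have e' := h.z3' p p' x r
    rw [← cyc a x r, A_def, mul_sub, h.b_ra] at e'
    rw [A_def] at e
    linear_combination (norm := abel) e - e'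
  refine ⟨h.a_br x, h.bra x, fun r => ?_, fun r => ?_, fun r => ?_, k⟩
  · have e := h.z2' p p' r x
    rw [s23, A_def, h.arb, zero_mul, zero_sub, neg_neg] at e
    exact e
  · have e := h.z2 p p' x r
    rw [A_def, k, sub_zero] at e
    exact e
  · have e := h.z3 p p' r x
    have e' := h.z1' p p' r x
    rw [s12, A_def, h.a_rb, zero_mul, zero_sub, neg_neg] at e'
    rw [s12, A_def, mul_neg, mul_sub, e'] at e
    simpa using e
theorem Orth.mull (x : R) : Orth a (x * b) := by
  have k : ∀ r, a * (r * (x * b)) = 0 := by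
    intro r
    have e := h.z3 p p' r x
    rw [← cyc b r x, A_def, mul_sub, h.a_rb] at e
    simpa using e
  have k' : ∀ r, x * b * (r * a) = 0 := by
    intro r
    have e := h.z1 p p' r x
    rw [s13 x b (r * a), A_def, h.b_ra] at e
    simpa using e
  refine ⟨h.a_rb x, h.symm.rab x, fun r => ?_, fun r => ?_, k, k'⟩
  · have e := h.z1' p p' x r
    rw [← cyc (x * b) a r, A_def, k, sub_zero] at e
    exact e
  · have e := h.z1' p p' x r
    rw [s23, A_def, k', sub_zero, neg_eq_zero] at e
    exact e
end

theorem orth_final (P : Prm R) (a : R)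
    (H : ∀ b, Orth a b → (∀ x y, A a x y * b = 0) ∧ (∀ x y, A b x y * a = 0))
    (b : R) (h : Orth a b) : a = 0 ∨ b = 0 := by
  let B : AddSubgroup R :=
    { carrier := {b | Orth a b}
      zero_mem' := by constructor <;> simp
      add_mem' := fun {x y} hx hy => by
        constructor <;> simp [mul_add, add_mul, hx.ab, hx.ba, hx.arb, hx.bra, hx.a_rb, hx.b_ra,
          hy.ab, hy.ba, hy.arb, hy.bra, hy.a_rb, hy.b_ra]
      neg_mem' := fun {x} hx => by
        constructor <;> simp [hx.ab, hx.ba, hx.arb, hx.bra, hx.a_rb, hx.b_ra] }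
  have hB : IsTwoSidedIdealSet B := fun r x hx =>
    ⟨Orth.mull hx (H x hx).1 (H x hx).2 r, Orth.mulr hx (H x hx).1 (H x hx).2 r⟩
  exact ann P B hB a (fun b hb => hb.ab) b h

theorem L3 (tor3 : ∀ x : R, (3 : ℕ) • x = 0 → x = 0) (P : Prm R) (a : R) (ha : T0 a) : a = 0 := by
  have ho : Orth a a := ⟨ha.1, ha.1, ha.2, ha.2, fun r => by rw [← flex, ha.2],
    fun r => by rw [← flex, ha.2]⟩
  have := orth_final P a (fun b h => ⟨fun x y => ?_, fun x y => ?_⟩) a ho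
  · rcases this with h | h <;> exact h
  · apply L2 P _ (nuc tor3 h x y)
    have e := (ha.mulr (A b x y)).neg
    rwa [e3 h, neg_neg] at e
  · exact L2 P _ (nuc tor3 h.symm x y) (ha.mull _)

theorem nondeg (tor3 : ∀ x : R, (3 : ℕ) • x = 0 → x = 0) (P : Prm R) (a : R)
    (ha : ∀ r, a * r * a = 0) : a = 0 := by
  apply L3 tor3 P a ⟨?_, ha⟩
  apply L3 tor3 P
  constructor
  · rw [← AltR.r, ha, zero_mul]
  · intro r
    rw [U1, ha, zero_mul]

theorem p_zero (tor3 : ∀ x : R, (3 : ℕ) • x = 0 → x = 0) (P : Prm R) {a b : R}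
    (h : Orth a b) (x y : R) : A a x y * b = 0 := by
  apply nondeg tor3 P
  intro s
  have N := nuc tor3 h
  -- multiplication of the nuclear elements
  have q1 : ∀ x y z w, A a x y * b * (z * w) = A a x y * b * z * w := by
    intro x y z w
    have := N x y z w
    rw [A_def, sub_eq_zero] at this; exact this.symm
  have q2 : ∀ x y z w, z * (A a x y * b) * w = z * (A a x y * b * w) := by
    intro x y z w
    have := N x y z w
    rw [s12, A_def, neg_eq_zero, sub_eq_zero] at this; exact this
  have pn : ∀ x y u v w, A a x y * b * A u v w = A (A a x y * b * u) v w := by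
    intro x y u v w
    have t := T (A a x y * b) u v w
    rw [N, N, N] at t
    simpa using t.symm
  have pb : ∀ x y, A a x y * b * b = 0 := by
    intro x y
    have e := e3 h x y
    rw [← neg_eq_zero, ← neg_mul, ← e, h.arb]
  have pa : ∀ x y, A a x y * b * a = 0 := fun x y => h.symm.rab _
  have psa : A a x y * b * (s * a) = - (a * y * (A a x s * b)) := by
    have w0 : ∀ w, A a x (w * a) * b = 0 := by
      intro w
      rw [cyc (w * a) a x, Ayx, neg_mul, h.arb, neg_zero]
    have w1 : ∀ w, A a x (a * w) * b = 0 := by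
      intro w
      rw [cyc (a * w) a x, Axy, neg_mul, h.rab, neg_zero]
    have D2 : ∀ y z, A a x (y * z) * b = y * (A a x z * b) + A a x y * b * z := by
      intro y z
      rw [s23 a (y * z) x, neg_mul, der h, s23 a x z, s23 a x y]; simp only [neg_mul, mul_neg]; abel
    have e := D2 y (s * a)
    have f : A a x (A a y s) * b = a * y * (A a x s * b) := by
      rw [A_def a y s, A_sub3, sub_mul, w1, D2, w1]; simp
    rw [← cyc a y s, A_def y s a, A_sub3, sub_mul, w0, e, w0] at f
    rw [← f]; simp
  have e : A a x y * b * (s * (a * A b x y)) = 0 := by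
    have i := pn x y a (A b x y) s
    rw [pa, A_zero1, cyc s a (A b x y), A_def s a, mul_sub, q1 x y (s * a), psa] at i
    rw [neg_mul, q2, pn, pb, A_zero1] at i
    simpa using i
  rw [e3 h, mul_neg, mul_neg, neg_eq_zero] at e
  rw [← q1, e]

/-- one-sided orthogonality in both orders -/
structure Lite (a b : R) : Prop where
  ab : a * b = 0
  ba : b * a = 0
  arb : ∀ r, a * r * b = 0
  bra : ∀ r, b * r * a = 0

theorem Lite.symm {a b : R} (h : Lite a b) : Lite b a :=
  ⟨h.ba, h.ab, h.bra, h.arb⟩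

/-- the derivation attached to a pair -/
def d (a b x : R) : R := A a x b

theorem d_sw (a b x : R) : d b a x = - d a b x := s13 _ _ _

theorem d_add (a b x y : R) : d a b (x + y) = d a b x + d a b y := A_add2 _ _ _ _

section
variable {a b : R} (h : Lite a b)
include h

theorem d1 (x : R) : a * (x * b) = - d a b x := by
  rw [d, A_def, h.arb]; simp
theorem d2 (x : R) : b * (x * a) = d a b x := by
  rw [d1 h.symm, d_sw, neg_neg]
theorem d3 (x : R) : x * a * b = - d a b x := by
  have : A x a b = - A a x b := s12 _ _ _
  rw [d, ← this, A_def, h.ab]; simp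
theorem d4 (x : R) : x * b * a = d a b x := by
  rw [d3 h.symm, d_sw, neg_neg]
theorem d5 (x : R) : a * (b * x) = d a b x := by
  have : A a b x = - A a x b := s23 _ _ _
  rw [d, ← neg_neg (A a x b), ← this, A_def, h.ab]; simp
theorem d6 (x : R) : b * (a * x) = - d a b x := by
  rw [d5 h.symm, d_sw]
theorem dder (x y : R) : d a b (x * y) = x * d a b y + d a b x * y := by
  have e : ∀ x, d a b x = A x b a := fun x => (cyc a x b).symm
  rw [e, e, e, I1, h.ba, h.ab, sub_zero, A_zero1, sub_zero]
theorem ad (x : R) : a * d a b x = 0 := by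
  rw [← neg_neg (d a b x), ← d6 h, mul_neg, ← M1, h.ab]; simp
theorem bd (x : R) : b * d a b x = 0 := by
  rw [← d5 h, ← M1, h.ba]; simp
theorem da (x : R) : d a b x * a = 0 := by
  rw [← neg_neg (d a b x), ← d3 h, neg_mul, M2, h.ba]; simp
theorem db (x : R) : d a b x * b = 0 := by
  rw [← d4 h, M2, h.ab]; simp
omit h in
theorem d_a : d a b a = 0 := A_xxy _ _
omit h in
theorem d_b : d a b b = 0 := A_yxx _ _
theorem d_xa (x : R) : d a b (x * a) = 0 := by rw [dder h, d_a, da h]; simp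
theorem d_ax (x : R) : d a b (a * x) = 0 := by rw [dder h, d_a, ad h]; simp
theorem d_xb (x : R) : d a b (x * b) = 0 := by rw [dder h, d_b, db h]; simp
theorem d_bx (x : R) : d a b (b * x) = 0 := by rw [dder h, d_b, bd h]; simp
theorem ddmul (x y : R) : d a b x * d a b y = 0 := by
  have e : x * a * (y * a) = x * a * y * a - a * A a x y := by
    have := Ayx a x y
    rw [s23 _ y a, A_def (x * a)] at this
    linear_combination (norm := abel) this
  rw [← d2 h x, ← neg_neg (d a b y), ← d3 h y, mul_neg, M3, e, sub_mul, h.arb, d3 h, sub_zero,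
    mul_neg, bd h]
  simp

/-- the alternating form -/
theorem xad (x : R) : x * a * d a b x = 0 := by
  rw [← d2 h, U2, h.bra]; simp
theorem h_self (x : R) : A a x (d a b x) = 0 := by
  rw [s12, A_def, xad h, ad h]; simp
theorem h_sw (x y : R) : A a y (d a b x) = - A a x (d a b y) := by
  have e := h_self h (x + y)
  rw [d_add, A_add2, A_add3, A_add3, h_self h, h_self h] at e
  linear_combination (norm := abel) e
theorem k_sw (x y : R) : A b y (d a b x) = - A b x (d a b y) := by
  have e := h_sw h.symm x y
  rw [d_sw a b x, d_sw a b y, A_neg3, A_neg3] at e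
  linear_combination (norm := abel) -e
theorem f1 (x y : R) : x * a * d a b y = - A a x (d a b y) := by
  rw [← s12, A_def, ad h]; simp
/-- `(x ∂y) a` -/
theorem f2 (x y : R) : x * d a b y * a = A a x (d a b y) := by
  rw [← cyc, A_def, da h]; simp
/-- `(∂x y) a` -/
theorem f3 (x y : R) : d a b x * y * a = - A a x (d a b y) := by
  have e := da h (x * y)
  rw [dder h, add_mul, f2 h] at e
  linear_combination (norm := abel) e
theorem f4 (x y : R) : d a b x * (y * a) = - (2 • A a x (d a b y)) := by
  have e : A (d a b x) y a = A a x (d a b y) := by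
    rw [cyc a (d a b x) y, s23, h_sw h, neg_neg]
  rw [A_def, f3 h] at e
  linear_combination (norm := abel) -e
/-- `a (∂x y)` -/
theorem f5 (x y : R) : a * (d a b x * y) = - A a x (d a b y) := by
  have e : A a (d a b x) y = A a x (d a b y) := by
    rw [s23, h_sw h, neg_neg]
  rw [A_def, ad h, zero_mul] at e
  linear_combination (norm := abel) -e
/-- `a (x ∂y)` -/
theorem f6 (x y : R) : a * (x * d a b y) = A a x (d a b y) := by
  have e := ad h (x * y)
  rw [dder h, mul_add, f5 h] at e
  linear_combination (norm := abel) e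
theorem f7 (x y : R) : a * x * d a b y = 2 • A a x (d a b y) := by
  have e : A a x (d a b y) = a * x * d a b y - a * (x * d a b y) := rfl
  rw [f6 h] at e
  linear_combination (norm := abel) -e
theorem f8 (x y : R) : d a b x * (a * y) = A a x (d a b y) := by
  have e : A (d a b x) a y = - A a x (d a b y) := by
    rw [cyc (d a b x) a y |>.symm, h_sw h]
  rw [A_def, da h, zero_mul] at e
  linear_combination (norm := abel) -e

theorem tfact (s x : R) : b * s * d a b x = - (2 • (d a b x * (b * s))) := by
  have e1 := f7 h.symm s x
  have e2 := f8 h.symm x s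
  have e3 := k_sw h s x
  rw [d_sw a b x] at e1
  rw [d_sw a b x, d_sw a b s] at e2
  simp only [mul_neg, neg_mul, A_neg3, neg_inj, smul_neg] at e1 e2
  rw [e1, e2, e3]; abel

theorem key0 (x s : R) : A a x (d a b (x * (b * s))) = 0 := by
  set t := b * s with ht
  have dt : d a b t = 0 := d_bx h s
  have dxt : d a b (x * t) = d a b x * t := by rw [dder h, dt]; simp
  have dtx : d a b (t * x) = - (2 • d a b (x * t)) := by rw [dxt, dder h, dt, ht, tfact h]; simp
  have h2 : A a x (d a b (t * x)) = - (2 • A a x (d a b (x * t))) := by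
    rw [dtx, A_neg3, two_nsmul, A_add3, two_nsmul]
  have act : A a (d a b x) t = 0 := by
    rw [s23, h_sw h, dt]; simp [A]
  have i1 := I1 x a (d a b x) t
  have i2 := I1 a x (d a b x) t
  have g1 : A (x * a) (d a b x) t = A a x (d a b (x * t)) := by
    rw [A_def, xad h, ← dxt, f1 h]; simp
  have g2 : A (a * x) (d a b x) t = - (2 • A a x (d a b (x * t))) := by
    rw [A_def, f7 h, h_self h, ← dxt, f7 h]; simp
  have v : A x (d a b x) t = d a b (x * t * x) - x * t * d a b x - d a b x * (t * x) := by
    rw [← cyc, A_def, dder h (x * t), dxt]; abel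
  have av : a * A x (d a b x) t = A a x (d a b (x * t)) + A a x (d a b (t * x)) := by
    rw [v, mul_sub, mul_sub, ad h, f6 h, f5 h, h_sw h x]; abel
  have va : A x (d a b x) t * a = A a x (d a b (x * t)) + A a x (d a b (t * x)) := by
    rw [v, sub_mul, sub_mul, da h, f2 h, f3 h, h_sw h x]; abel
  rw [g1, va, act] at i1
  rw [g2, av, act, s23 _ x a] at i2
  simp only [zero_mul, mul_zero] at i1 i2
  rw [h2] at i1 i2
  linear_combination (norm := abel) i1 + i2

theorem Ud (x s : R) : d a b x * s * d a b x = 0 := by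
  have hcm : d a b x * (x * a) = 0 := by rw [f4 h, h_self h]; simp
  have dxt : d a b (x * (b * s)) = d a b x * (b * s) := by rw [dder h, d_bx h]; simp
  have htc : b * s * d a b x = - (2 • d a b (x * (b * s))) := by rw [tfact h, dxt]
  have htcm : b * s * d a b x * (x * a) = 0 := by
    rw [htc, neg_mul, smul_mul_assoc, f4 h, h_sw h, key0 h]; simp
  have k1 : d a b x * (x * a * (b * s)) = 0 := by
    have e : A (d a b x) (x * a) (b * s) = A (b * s) (d a b x) (x * a) := cyc _ _ _
    rw [A_def, A_def, hcm, htcm] at e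
    simpa using e
  have k2 : d a b x * (s * (x * a) * b) = 0 := by
    rw [← d2 h x, M3, ← flex (x * a) s, U1, d3 h, mul_neg, bd h, neg_zero]
  have k3 : d a b x * (d a b x * s) = 0 := by
    rw [← AltR.l, ddmul h, zero_mul]
  have e : s * (x * a) * b - s * (x * a * b) = x * a * b * s - x * a * (b * s) := by
    have := cyc s (x * a) b
    rw [A_def, A_def] at this
    exact this.symm
  rw [d3 h] at e
  have e' : s * d a b x = - (s * (x * a) * b) - d a b x * s - x * a * (b * s) := by
    simp only [mul_neg, neg_mul] at e
    linear_combination (norm := abel) e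
  rw [flex, e', mul_sub, mul_sub, mul_neg, k1, k2, k3]; simp
end

theorem main (tor3 : ∀ x : R, (3 : ℕ) • x = 0 → x = 0) (P : Prm R) (a b : R)
    (hab : ∀ r, a * r * b = 0) : a = 0 ∨ b = 0 := by
  have ba : b * a = 0 := by
    apply nondeg tor3 P
    intro s
    rw [U1, flex, hab]; simp
  have ab : a * b = 0 := by
    apply nondeg tor3 P
    intro s
    rw [U1, flex, hab]
  have bra : ∀ x, b * x * a = 0 := by
    intro x
    apply nondeg tor3 P
    intro s
    rw [U1, flex, U2, hab]; simp
  have L : Lite a b := ⟨ab, ba, hab, bra⟩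
  have d0 : ∀ x, d a b x = 0 := fun x => nondeg tor3 P _ (Ud L x)
  have O : Orth a b := by
    refine ⟨ab, ba, hab, bra, ?_, ?_⟩
    · intro r; rw [d1 L, d0, neg_zero]
    · intro r; rw [d2 L, d0]
  exact orth_final P a (fun b h => ⟨p_zero tor3 P h, p_zero tor3 P h.symm⟩) b O

end Alt

/-- a 3-torsion free alternative ring is prime (AB ≠ 0 for any two
nonzero two-sided ideals A, B) iff `(a r) b = 0` for all `r` implies `a = 0` or `b = 0`. -/
theorem stmt0 {R : Type*} [NonUnitalNonAssocRing R]
    (alt1 : ∀ x y : R, x * x * y = x * (x * y))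
    (alt2 : ∀ x y : R, y * x * x = y * (x * x))
    (tor3 : ∀ x : R, (3 : ℕ) • x = 0 → x = 0) :
    (∀ A B : AddSubgroup R, IsTwoSidedIdealSet A → IsTwoSidedIdealSet B →
        (∃ a ∈ A, a ≠ 0) → (∃ b ∈ B, b ≠ 0) → ∃ a ∈ A, ∃ b ∈ B, a * b ≠ 0) ↔
    (∀ a b : R, (∀ r : R, a * r * b = 0) → a = 0 ∨ b = 0) := by
  constructor
  · intro P a b hab
    haveI : Alt.AltR R := ⟨alt1, alt2⟩
    exact Alt.main tor3 P a b hab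
  · rintro H A B hA hB ⟨a, ha, ha0⟩ ⟨b, hb, hb0⟩
    by_contra! hc
    rcases H a b (fun r => hc _ (hA r a ha).2 b hb) with h | h
    · exact ha0 h
    · exact hb0 h
end

section
/- Let R be a unital 2- and 3-torsion free alternative ring with a nontrivial idempotent e_1, e_2 = 1 − e_1, satisfying: for each i ∈ {1,2}, if x ∈ R has (x r)e_i = 0 for all r ∈ R, then x = 0. Let φ : R → R be an additive commuting map. Then for all i ≠ j in {1,2} and every x_ij ∈ R_ij, the element e_i φ(x_ij) e_i + e_j φ(x_ij) e_j lies in Z(R), i.e. [e_i φ(x_ij) e_i + e_j φ(x_ij) e_j, r] = 0 for all r ∈ R. -/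
/-- The pair of Peirce idempotents associated to an idempotent `e`:
`peirceE e 0 = e₁ = e` and `peirceE e 1 = e₂ = 1 - e`. -/
def peirceE {R : Type*} [NonAssocRing R] (e : R) (i : Fin 2) : R :=
  if i = 0 then e else 1 - e

/-- The Peirce component `R_ij = eᵢ R eⱼ` of a unital alternative ring relative
to the idempotent `e` (indices `0, 1` standing for `1, 2`). -/
def peirceSet {R : Type*} [NonAssocRing R] (e : R) (i j : Fin 2) : Set R :=
  {x : R | ∃ a : R, x = peirceE e i * (a * peirceE e j)}


/-- `x` is a simultaneous eigenvector of left and right multiplication by `e`. -/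
def PMem {R : Type*} [NonAssocRing R] (e : R) (α β : ℤ) (x : R) : Prop :=
  e * x = α • x ∧ x * e = β • x

section aux
variable {R : Type*} [NonAssocRing R]

lemma assoc_swap_left (alt1 : ∀ x y : R, x * x * y = x * (x * y)) (a b c : R) :
    associator a b c = - associator b a c := by
  have h := alt1 (a + b) c
  simp only [add_mul, mul_add, alt1] at h
  simp only [associator]
  linear_combination (norm := module) h

lemma assoc_swap_right (alt2 : ∀ x y : R, y * x * x = y * (x * x)) (a b c : R) :
    associator a b c = - associator a c b := by
  have h := alt2 (b + c) a
  simp only [add_mul, mul_add, alt2] at h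
  simp only [associator]
  linear_combination (norm := module) h

lemma PMem.mul (alt1 : ∀ x y : R, x * x * y = x * (x * y))
    (alt2 : ∀ x y : R, y * x * x = y * (x * x)) {e x y : R} {α β γ δ : ℤ}
    (hx : PMem e α β x) (hy : PMem e γ δ y) (α' β' : ℤ)
    (h1 : α' = α + β - γ := by norm_num) (h2 : β' = δ + γ - β := by norm_num) :
    PMem e α' β' (x * y) := by
  have p := assoc_swap_left alt1 e x y
  have q := assoc_swap_right alt2 x y e
  simp only [associator, hx.1, hx.2, hy.1, hy.2, smul_mul_assoc, mul_smul_comm] at p q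
  subst h1 h2
  constructor
  · linear_combination (norm := module) -p
  · linear_combination (norm := module) q

lemma PMem.sq_eq {e x : R} {α β : ℤ} (alt1 : ∀ x y : R, x * x * y = x * (x * y))
    (he : e * e = e) (hx : PMem e α β x) : (α * α - α) • x = 0 := by
  have h := alt1 e x
  simp only [he, hx.1, mul_smul_comm] at h
  linear_combination (norm := module) -h

lemma PMem.sq_eq' {e x : R} {α β : ℤ} (alt2 : ∀ x y : R, y * x * x = y * (x * x))
    (he : e * e = e) (hx : PMem e α β x) : (β * β - β) • x = 0 := by
  have h := alt2 e x
  simp only [he, hx.2, smul_mul_assoc] at h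
  linear_combination (norm := module) h

lemma PMem.zero_l {e x : R} {α β : ℤ} (alt1 : ∀ x y : R, x * x * y = x * (x * y))
    (tor2 : ∀ x : R, (2 : ℕ) • x = 0 → x = 0)
    (he : e * e = e) (hx : PMem e α β x) (h : α * α - α = 2 := by norm_num) : x = 0 := by
  have := hx.sq_eq alt1 he
  rw [h] at this
  exact tor2 x (by exact_mod_cast this)

lemma PMem.zero_r {e x : R} {α β : ℤ} (alt2 : ∀ x y : R, y * x * x = y * (x * x))
    (tor2 : ∀ x : R, (2 : ℕ) • x = 0 → x = 0)
    (he : e * e = e) (hx : PMem e α β x) (h : β * β - β = 2 := by norm_num) : x = 0 := by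
  have := hx.sq_eq' alt2 he
  rw [h] at this
  exact tor2 x (by exact_mod_cast this)

lemma PMem.add {e x y : R} {α β : ℤ} (hx : PMem e α β x) (hy : PMem e α β y) :
    PMem e α β (x + y) := by
  constructor
  · rw [mul_add, hx.1, hy.1, smul_add]
  · rw [add_mul, hx.2, hy.2, smul_add]

lemma PMem.sub {e x y : R} {α β : ℤ} (hx : PMem e α β x) (hy : PMem e α β y) :
    PMem e α β (x - y) := by
  constructor
  · rw [mul_sub, hx.1, hy.1, smul_sub]
  · rw [sub_mul, hx.2, hy.2, smul_sub]

lemma pmem_zero (e : R) (α β : ℤ) : PMem e α β 0 := by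
  simp [PMem]

lemma pmem_indep {e a b c d : R} (ha : PMem e 1 1 a) (hb : PMem e 1 0 b) (hc : PMem e 0 1 c)
    (hd : PMem e 0 0 d) (h : a + b + c + d = 0) : a = 0 ∧ b = 0 ∧ c = 0 ∧ d = 0 := by
  have h1 : a + b = 0 := by
    have := congrArg (e * ·) h
    simpa [mul_add, ha.1, hb.1, hc.1, hd.1] using this
  have h2 : a = 0 := by
    have := congrArg (· * e) h1
    simpa [add_mul, ha.2, hb.2] using this
  subst h2
  have h3 : b = 0 := by simpa using h1
  subst h3
  have h4 : c = 0 := by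
    have := congrArg (· * e) h
    simpa [add_mul, hc.2, hd.2] using this
  subst h4
  simpa using h

lemma flex' (alt1 : ∀ x y : R, x * x * y = x * (x * y))
    (alt2 : ∀ x y : R, y * x * x = y * (x * x)) (e r : R) : e * r * e = e * (r * e) := by
  have p := assoc_swap_left alt1 e r e
  have := alt2 e r
  simp only [associator, this, sub_self, neg_zero] at p
  exact sub_eq_zero.mp p

lemma pmem_decomp (alt1 : ∀ x y : R, x * x * y = x * (x * y))
    (alt2 : ∀ x y : R, y * x * x = y * (x * x)) {e : R} (he : e * e = e) (r : R) :
    ∃ a b c d, PMem e 1 1 a ∧ PMem e 1 0 b ∧ PMem e 0 1 c ∧ PMem e 0 0 d ∧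
      r = a + b + c + d ∧ e * (r * e) + (1 - e) * (r * (1 - e)) = a + d := by
  have l : ∀ y, e * (e * y) = e * y := fun y => by rw [← alt1, he]
  have m : ∀ y, y * e * e = y * e := fun y => by rw [alt2, he]
  have f := flex' alt1 alt2 e
  refine ⟨e * (r * e), e * r - e * (r * e), r * e - e * (r * e),
    r - e * r - r * e + e * (r * e), ?_, ?_, ?_, ?_, ?_, ?_⟩
  · simp [PMem, l, m, f]
  · simp [PMem, l, m, f, mul_sub, sub_mul]
  · simp [PMem, l, m, f, mul_sub, sub_mul]
  · simp [PMem, l, m, f, mul_sub, sub_mul, mul_add, add_mul]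
  · abel
  · simp [mul_sub, sub_mul]
    abel

lemma core (alt1 : ∀ x y : R, x * x * y = x * (x * y))
    (alt2 : ∀ x y : R, y * x * x = y * (x * x))
    (tor2 : ∀ x : R, (2 : ℕ) • x = 0 → x = 0)
    (e : R) (he : e * e = e)
    (hd1 : ∀ x : R, (∀ r : R, x * r * e = 0) → x = 0)
    (φ : R → R) (hadd : ∀ x y : R, φ (x + y) = φ x + φ y)
    (hcomm : ∀ x : R, φ x * x = x * φ x) (x : R) (hx : PMem e 1 0 x) (r : R) :
    (e * (φ x * e) + (1 - e) * (φ x * (1 - e))) * r =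
      r * (e * (φ x * e) + (1 - e) * (φ x * (1 - e))) := by
  have lin : ∀ u v, φ u * v - v * φ u = u * φ v - φ v * u := by
    intro u v
    have h := hcomm (u + v)
    simp only [hadd, mul_add, add_mul, hcomm u, hcomm v] at h
    linear_combination (norm := module) h
  have dec := pmem_decomp alt1 alt2 he
  -- multiplication table, zero products
  have z1122 : ∀ {u v}, PMem e 1 1 u → PMem e 0 0 v → u * v = 0 := fun hu hv =>
    (hu.mul alt1 alt2 hv 2 (-1)).zero_l alt1 tor2 he
  have z1121 : ∀ {u v}, PMem e 1 1 u → PMem e 0 1 v → u * v = 0 := fun hu hv =>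
    (hu.mul alt1 alt2 hv 2 0).zero_l alt1 tor2 he
  have z1211 : ∀ {u v}, PMem e 1 0 u → PMem e 1 1 v → u * v = 0 := fun hu hv =>
    (hu.mul alt1 alt2 hv 0 2).zero_r alt2 tor2 he
  have z2212 : ∀ {u v}, PMem e 0 0 u → PMem e 1 0 v → u * v = 0 := fun hu hv =>
    (hu.mul alt1 alt2 hv (-1) 1).zero_l alt1 tor2 he
  have z2211 : ∀ {u v}, PMem e 0 0 u → PMem e 1 1 v → u * v = 0 := fun hu hv =>
    (hu.mul alt1 alt2 hv (-1) 2).zero_l alt1 tor2 he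
  have z2122 : ∀ {u v}, PMem e 0 1 u → PMem e 0 0 v → u * v = 0 := fun hu hv =>
    (hu.mul alt1 alt2 hv 1 (-1)).zero_r alt2 tor2 he
  have he11 : PMem e 1 1 e := by simp [PMem, he]
  -- φ e is diagonal
  have diag_e : ∃ p q, PMem e 1 1 p ∧ PMem e 0 0 q ∧ φ e = p + q := by
    obtain ⟨a, b, c, d, ha, hb, hc, hd, h, -⟩ := dec (φ e)
    have h0 := hcomm e
    simp [h, add_mul, mul_add, ha.1, ha.2, hb.1, hb.2, hc.1, hc.2, hd.1, hd.2] at h0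
    have := pmem_indep (pmem_zero e 1 1) hb ((pmem_zero e 0 1).sub hc) (pmem_zero e 0 0)
      (by linear_combination (norm := module) -h0)
    obtain ⟨-, h1, h2, -⟩ := this
    refine ⟨a, d, ha, hd, ?_⟩
    have h3 : c = 0 := by simpa using h2
    rw [h, h1, h3]; abel
  obtain ⟨p, q, hp, hq, hpq⟩ := diag_e
  have diag_11 : ∀ s, PMem e 1 1 s → ∃ p q, PMem e 1 1 p ∧ PMem e 0 0 q ∧ φ s = p + q := by
    intro s hs
    obtain ⟨a, b, c, d, ha, hb, hc, hd, h, -⟩ := dec (φ s)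
    have h0 := lin s e
    simp [h, hpq, add_mul, mul_add, ha.1, ha.2, hb.1, hb.2, hc.1, hc.2, hd.1, hd.2,
      z1122 hs hq, z2211 hq hs] at h0
    have := pmem_indep ((hs.mul alt1 alt2 hp 1 1).sub (hp.mul alt1 alt2 hs 1 1)) hb
      ((pmem_zero e 0 1).sub hc) (pmem_zero e 0 0)
      (by linear_combination (norm := module) -h0)
    obtain ⟨-, h1, h2, -⟩ := this
    refine ⟨a, d, ha, hd, ?_⟩
    have h3 : c = 0 := by simpa using h2
    rw [h, h1, h3]; abel
  have diag_22 : ∀ s, PMem e 0 0 s → ∃ p q, PMem e 1 1 p ∧ PMem e 0 0 q ∧ φ s = p + q := by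
    intro s hs
    obtain ⟨a, b, c, d, ha, hb, hc, hd, h, -⟩ := dec (φ s)
    have h0 := lin s e
    simp [h, hpq, add_mul, mul_add, ha.1, ha.2, hb.1, hb.2, hc.1, hc.2, hd.1, hd.2,
      z1122 hp hs, z2211 hs hp] at h0
    have := pmem_indep (pmem_zero e 1 1) hb
      ((pmem_zero e 0 1).sub hc) ((hs.mul alt1 alt2 hq 0 0).sub (hq.mul alt1 alt2 hs 0 0))
      (by linear_combination (norm := module) -h0)
    obtain ⟨-, h1, h2, -⟩ := this
    refine ⟨a, d, ha, hd, ?_⟩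
    have h3 : c = 0 := by simpa using h2
    rw [h, h1, h3]; abel
  obtain ⟨a, b, c, d, ha, hb, hc, hd, h, hA⟩ := dec (φ x)
  rw [hA]
  have hc0 : c = 0 := by
    have h0 := lin x e
    simp [h, hpq, add_mul, mul_add, ha.1, ha.2, hb.1, hb.2, hc.1, hc.2, hd.1, hd.2,
      z1211 hx hp, z2212 hq hx] at h0
    have := pmem_indep (pmem_zero e 1 1)
      ((hx.mul alt1 alt2 hq 1 0).sub (hp.mul alt1 alt2 hx 1 0) |>.add hb)
      ((pmem_zero e 0 1).sub hc) (pmem_zero e 0 0)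
      (by linear_combination (norm := module) -h0)
    simpa using this.2.2.1
  subst hc0
  have c11 : ∀ s, PMem e 1 1 s → a * s = s * a := by
    intro s hs
    obtain ⟨u, v, hu, hv, huv⟩ := diag_11 s hs
    have h0 := lin x s
    simp [h, huv, add_mul, mul_add, z1122 hs hd, z2211 hd hs, z1211 hb hs,
      z1211 hx hu, z2212 hv hx] at h0
    have := pmem_indep ((ha.mul alt1 alt2 hs 1 1).sub (hs.mul alt1 alt2 ha 1 1))
      ((hu.mul alt1 alt2 hx 1 0).sub (hs.mul alt1 alt2 hb 1 0) |>.sub (hx.mul alt1 alt2 hv 1 0))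
      (pmem_zero e 0 1) (pmem_zero e 0 0)
      (by linear_combination (norm := module) h0)
    exact sub_eq_zero.mp this.1
  have c22 : ∀ s, PMem e 0 0 s → d * s = s * d := by
    intro s hs
    obtain ⟨u, v, hu, hv, huv⟩ := diag_22 s hs
    have h0 := lin x s
    simp [h, huv, add_mul, mul_add, z1122 ha hs, z2211 hs ha, z2212 hs hb,
      z1211 hx hu, z2212 hv hx] at h0
    have := pmem_indep (pmem_zero e 1 1)
      ((hu.mul alt1 alt2 hx 1 0).add (hb.mul alt1 alt2 hs 1 0) |>.sub (hx.mul alt1 alt2 hv 1 0))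
      (pmem_zero e 0 1) ((hd.mul alt1 alt2 hs 0 0).sub (hs.mul alt1 alt2 hd 0 0))
      (by linear_combination (norm := module) h0)
    exact sub_eq_zero.mp this.2.2.2
  have c21 : ∀ s, PMem e 0 1 s → d * s = s * a := by
    intro s hs
    obtain ⟨k, l, m, n, hk, hl, hm, hn, hs', -⟩ := dec (φ s)
    have hl0 : l = 0 := by
      have h0 := lin s e
      simp [hs', hpq, add_mul, mul_add, hk.1, hk.2, hl.1, hl.2, hm.1, hm.2, hn.1, hn.2,
        z1121 hp hs, z2122 hs hq] at h0
      have := pmem_indep (pmem_zero e 1 1) hl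
        ((hs.mul alt1 alt2 hp 0 1).sub (hq.mul alt1 alt2 hs 0 1) |>.sub hm)
        (pmem_zero e 0 0)
        (by linear_combination (norm := module) -h0)
      exact this.2.1
    subst hl0
    have h0 := lin x s
    simp [h, hs', add_mul, mul_add, z1121 ha hs, z2122 hs hd, z1211 hx hk, z2212 hn hx] at h0
    have := pmem_indep
      ((hb.mul alt1 alt2 hs 1 1).sub (hx.mul alt1 alt2 hm 1 1))
      ((hk.mul alt1 alt2 hx 1 0).sub (hx.mul alt1 alt2 hn 1 0))
      ((hd.mul alt1 alt2 hs 0 1).sub (hs.mul alt1 alt2 ha 0 1))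
      ((hm.mul alt1 alt2 hx 0 0).sub (hs.mul alt1 alt2 hb 0 0))
      (by linear_combination (norm := module) h0)
    exact sub_eq_zero.mp this.2.2.1
  have c12 : ∀ y, PMem e 1 0 y → a * y = y * d := by
    intro y hy
    have hw : PMem e 1 0 (a * y - y * d) :=
      (ha.mul alt1 alt2 hy 1 0).sub (hy.mul alt1 alt2 hd 1 0)
    have w21 : ∀ z, PMem e 0 1 z → (a * y - y * d) * z = 0 := by
      intro z hz
      -- (a,y,z) = 0
      have i1 : a * y * z = a * (y * z) := by
        have t := assoc_swap_right alt2 a y z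
        have t' := z1121 ha hz
        have t2 := z1122 ha (hz.mul alt1 alt2 hy 0 0)
        simp [associator, t', t2] at t
        exact sub_eq_zero.mp t
      have i2 : y * d * z = y * (d * z) := by
        have t := assoc_swap_left alt1 y d z
        have t' := z2212 hd hy
        have t2 := z2211 hd (hy.mul alt1 alt2 hz 1 1)
        simp [associator, t', t2] at t
        exact sub_eq_zero.mp t
      have i3 : y * (z * a) = y * z * a := by
        have t := assoc_swap_left alt1 y z a
        have t' := z1211 hy ha
        have t2 := z2211 (hz.mul alt1 alt2 hy 0 0) ha
        simp [associator, t', t2] at t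
        exact (sub_eq_zero.mp t).symm
      rw [sub_mul, i1, i2, c21 z hz, i3, c11 _ (hy.mul alt1 alt2 hz 1 1), sub_self]
    have w12 : ∀ z, PMem e 1 0 z → (a * y - y * d) * z = 0 := by
      intro z hz
      have hyz := hy.mul alt1 alt2 hz 0 1
      have i1 : a * y * z = y * z * a := by
        have t := assoc_swap_left alt1 a y z
        rw [assoc_swap_right alt2 y a z] at t
        simp [associator, z1211 hz ha, z1121 ha hyz] at t
        exact t
      have i2 : y * d * z = d * (y * z) := by
        have t := assoc_swap_left alt1 y d z
        simp [associator, z2212 hd hy, z2212 hd hz] at t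
        exact t
      rw [sub_mul, i1, i2, c21 _ hyz, sub_self]
    refine sub_eq_zero.mp (hd1 _ fun r => ?_)
    obtain ⟨k, l, m, n, hk, hl, hm, hn, hr, -⟩ := dec r
    rw [hr]
    simp only [mul_add, add_mul, w12 l hl, w21 m hm, z1211 hw hk,
      (hw.mul alt1 alt2 hn 1 0).2]
    simp
  obtain ⟨k, l, m, n, hk, hl, hm, hn, hr, -⟩ := dec r
  rw [hr]
  simp only [mul_add, add_mul, c11 k hk, c12 l hl, c21 m hm, c22 n hn, z1121 ha hm, z1122 ha hn,
    z2211 hd hk, z2212 hd hl, z1211 hl ha, z2211 hn ha, z1122 hk hd, z2122 hm hd]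
  abel

lemma pmem_of (alt1 : ∀ x y : R, x * x * y = x * (x * y))
    (alt2 : ∀ x y : R, y * x * x = y * (x * x)) {e : R} (he : e * e = e) (a : R) :
    PMem e 1 0 (e * (a * (1 - e))) := by
  have l : ∀ y, e * (e * y) = e * y := fun y => by rw [← alt1, he]
  have m : ∀ y, y * e * e = y * e := fun y => by rw [alt2, he]
  have f := flex' alt1 alt2 e
  simp [PMem, l, m, f, mul_sub, sub_mul]

end aux

theorem stmt16 {R : Type*} [NonAssocRing R]
    (alt1 : ∀ x y : R, x * x * y = x * (x * y))
    (alt2 : ∀ x y : R, y * x * x = y * (x * x))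
    (tor2 : ∀ x : R, (2 : ℕ) • x = 0 → x = 0)
    (tor3 : ∀ x : R, (3 : ℕ) • x = 0 → x = 0)
    (e₁ : R) (he : e₁ * e₁ = e₁) (he0 : e₁ ≠ 0) (he1 : e₁ ≠ 1)
    (hd1 : ∀ x : R, (∀ r : R, x * r * e₁ = 0) → x = 0)
    (hd2 : ∀ x : R, (∀ r : R, x * r * (1 - e₁) = 0) → x = 0)
    (φ : R → R) (hadd : ∀ x y : R, φ (x + y) = φ x + φ y)
    (hcomm : ∀ x : R, φ x * x = x * φ x)
    :
    ∀ i j : Fin 2, i ≠ j → ∀ x ∈ peirceSet e₁ i j, ∀ r : R,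
      (peirceE e₁ i * (φ x * peirceE e₁ i) + peirceE e₁ j * (φ x * peirceE e₁ j)) * r =
        r * (peirceE e₁ i * (φ x * peirceE e₁ i) + peirceE e₁ j * (φ x * peirceE e₁ j))
    := by
  intro i j hij x hx r
  obtain ⟨a, rfl⟩ := hx
  have he' : (1 - e₁) * (1 - e₁) = 1 - e₁ := by simp [mul_sub, sub_mul, he]
  have hee : 1 - (1 - e₁) = e₁ := by abel
  fin_cases i <;> fin_cases j
  · exact absurd rfl hij
  · exact core alt1 alt2 tor2 e₁ he hd1 φ hadd hcomm _ (pmem_of alt1 alt2 he a) r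
  · have h := core alt1 alt2 tor2 (1 - e₁) he' hd2 φ hadd hcomm _ (pmem_of alt1 alt2 he' a) r
    rw [hee] at h
    exact h
  · exact absurd rfl hij
end

section
/- Let R be a unital 2- and 3-torsion free alternative ring with nontrivial idempotent e_1, e_2 = 1 − e_1, and Peirce decomposition R = R_11 ⊕ R_12 ⊕ R_21 ⊕ R_22, satisfying: (1) for i ≠ j, if x_ij ∈ R_ij has x_ij R_ji = 0, then x_ij = 0; (2) if x_11 ∈ R_11 has x_11 R_12 = 0 or R_21 x_11 = 0, then x_11 = 0; (3) if x_22 ∈ R_22 has R_12 x_22 = 0 or x_22 R_21 = 0, then x_22 = 0; (4) if z ∈ Z(R) with z ≠ 0, then zR = R. Let D : R → R be a multiplicative Lie derivation, i.e. D([x,y]) = [D(x), y] + [x, D(y)] for all x, y ∈ R (additivity of D is not assumed). Then D = δ + τ, where δ is an additive derivation of R and τ is a map from R into Z(R) sending all commutators to zero, if and only if (a) e_2 D(R_11) e_2 ⊆ Z(R) e_2 and (b) e_1 D(R_22) e_1 ⊆ Z(R) e_1. -/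
namespace LieAlt

/-- Associator. -/
def As {R : Type*} [NonAssocRing R] (a b c : R) : R := a * b * c - a * (b * c)

/-- Alternative ring without 2- and 3-torsion. -/
structure Alt (R : Type*) [NonAssocRing R] : Prop where
  l : ∀ x y : R, x * x * y = x * (x * y)
  r : ∀ x y : R, y * x * x = y * (x * x)
  t2 : ∀ x : R, (2 : ℕ) • x = 0 → x = 0
  t3 : ∀ x : R, (3 : ℕ) • x = 0 → x = 0

/-- Commutative center. -/
def Cen {R : Type*} [NonAssocRing R] (z : R) : Prop := ∀ r : R, z * r = r * z

/-- Peirce eigenspaces. -/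
def P {R : Type*} [NonAssocRing R] (e : R) (α β : ℤ) (x : R) : Prop :=
  e * x = α • x ∧ x * e = β • x

section basic
variable {R : Type*} [NonAssocRing R]

theorem Alt.tt (h : Alt R) {x : R} (hx : x + x = 0) : x = 0 := by
  apply h.t2; rw [two_nsmul]; exact hx

theorem Alt.sw12 (h : Alt R) (a b c : R) : As a b c = - As b a c := by
  have h1 := h.l (a + b) c
  have h2 := h.l a c
  have h3 := h.l b c
  simp only [add_mul, mul_add] at h1
  rw [h2, h3] at h1
  unfold As
  rw [← sub_eq_zero] at h1 ⊢
  rw [← h1]; abel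

theorem Alt.sw23 (h : Alt R) (a b c : R) : As a b c = - As a c b := by
  have h1 := h.r (b + c) a
  have h2 := h.r b a
  have h3 := h.r c a
  simp only [add_mul, mul_add] at h1
  rw [h2, h3] at h1
  unfold As
  rw [← sub_eq_zero] at h1 ⊢
  rw [← h1]; abel

theorem Alt.sw13 (h : Alt R) (a b c : R) : As a b c = - As c b a := by
  rw [h.sw12, h.sw23, h.sw12, neg_neg]

theorem Alt.cyc1 (h : Alt R) (a b c : R) : As a b c = As b c a := by
  rw [h.sw12, h.sw23, neg_neg]

theorem Alt.cyc2 (h : Alt R) (a b c : R) : As a b c = As c a b := by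
  rw [h.sw23, h.sw12, neg_neg]

theorem teich (w x y z : R) :
    As (w * x) y z - As w (x * y) z + As w x (y * z) - w * As x y z - As w x y * z = 0 := by
  unfold As
  simp only [mul_sub, sub_mul]
  abel

theorem Alt.core (h : Alt R) (a b x y : R) :
    As (a * b) x y - As (b * a) x y + As (x * y) a b - As x a b * y - x * As y a b = 0 := by
  have t1 := teich a b x y
  have t2 := teich a b y x
  have t3 := teich b a y x
  have t4 := teich b x a y
  have t5 := teich x a b y
  simp only [h.sw12 a (b * x) y,
    h.cyc2 a b (x * y),
    h.sw23 (a * b) y x,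
    h.sw12 a (b * y) x,
    h.cyc2 a b (y * x),
    h.sw23 b y x,
    h.sw23 (b * a) y x,
    h.sw12 b (a * y) x,
    h.sw13 b a (y * x),
    h.sw23 a y x,
    h.sw12 b a y,
    h.sw12 b (x * a) y,
    h.cyc2 b x (a * y),
    h.sw12 x a y,
    h.cyc2 b x a,
    h.sw12 x (a * b) y,
    h.sw13 x a (b * y),
    h.cyc1 x a b,
    h.cyc1 y a b] at t1 t2 t3 t4 t5 ⊢
  linear_combination (norm := skip) t1 + t2 + t3 - t4 + t5
  simp only [mul_neg, neg_mul]
  abel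

theorem Alt.nuc (h : Alt R) {z : R} (hz : Cen z) (a b : R) : As z a b = 0 := by
  apply h.t3
  have h1 := h.sw12 z a b
  have h2 := h.sw23 a z b
  have : (3 : ℕ) • As z a b = As z a b - As a z b + As a b z := by
    rw [h.sw12 a z b, show As a b z = As z a b by rw [h.sw23, h.sw12, neg_neg]]
    abel
  rw [this]
  unfold As
  rw [hz (a * b), hz a, hz b]
  abel

/-- An inner derivation. -/
def Del (a b x : R) : R := (a * b - b * a) * x - x * (a * b - b * a) - (3 : ℕ) • As a b x

theorem Del_add (a b x y : R) : Del a b (x + y) = Del a b x + Del a b y := by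
  unfold Del As
  simp only [mul_add, add_mul, mul_sub, sub_mul]
  abel

theorem Alt.Del_mul (h : Alt R) (a b x y : R) :
    Del a b (x * y) = Del a b x * y + x * Del a b y := by
  have hc := h.core a b x y
  obtain ⟨c, hcd⟩ : ∃ c, c = a * b - b * a := ⟨_, rfl⟩
  have h1 : As (a * b) x y - As (b * a) x y = As c x y := by
    simp only [As, hcd, sub_mul]; abel
  have e1 : As x y c = As c x y := by rw [h.sw23, h.sw12, neg_neg]
  have e2 : As x c y = - As c x y := by rw [h.sw12]
  have e3 : ∀ u, As u a b = As a b u := fun u => by rw [h.sw12, h.sw23, neg_neg]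
  have h2 : c * (x * y) - (x * y) * c - (c * x - x * c) * y - x * (c * y - y * c)
      = - (As c x y - As x c y + As x y c) := by
    simp only [As, mul_sub, sub_mul]; abel
  rw [h1, e3, e3, e3] at hc
  rw [e1, e2] at h2
  unfold Del
  rw [← hcd]
  have h3 : As a b (x * y) = As a b x * y + x * As a b y - As c x y := by
    rw [← sub_eq_zero, ← hc]; abel
  rw [h3, ← sub_eq_zero]
  have h4 : ((3:ℕ) • As a b x) * y = (3:ℕ) • (As a b x * y) := smul_mul_assoc _ _ _
  have h5 : x * ((3:ℕ) • As a b y) = (3:ℕ) • (x * As a b y) := mul_smul_comm _ _ _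
  rw [sub_mul _ ((3:ℕ) • As a b x), mul_sub x _ ((3:ℕ) • As a b y), h4, h5]
  have h6 : c * (x * y) = - (As c x y - -As c x y + As c x y) +  (x * y) * c + (c * x - x * c) * y + x * (c * y - y * c) := by
    rw [← h2]; abel
  rw [h6]
  abel

end basic

section peirce
variable {R : Type*} [NonAssocRing R] {e : R}

theorem P.add {α β : ℤ} {x y : R} (hx : P e α β x) (hy : P e α β y) : P e α β (x + y) :=
  ⟨by rw [mul_add, hx.1, hy.1, smul_add], by rw [add_mul, hx.2, hy.2, smul_add]⟩

theorem P.neg {α β : ℤ} {x : R} (hx : P e α β x) : P e α β (-x) :=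
  ⟨by rw [mul_neg, hx.1, smul_neg], by rw [neg_mul, hx.2, smul_neg]⟩

theorem P.sub {α β : ℤ} {x y : R} (hx : P e α β x) (hy : P e α β y) : P e α β (x - y) := by
  rw [sub_eq_add_neg]; exact hx.add hy.neg

theorem P.zero {α β : ℤ} : P e α β (0 : R) := ⟨by simp, by simp⟩

theorem P.swap {α β : ℤ} {x : R} (hx : P e α β x) : P (1 - e) (1 - α) (1 - β) x :=
  ⟨by rw [sub_mul, hx.1, sub_smul, one_smul, one_mul],
   by rw [mul_sub, hx.2, sub_smul, one_smul, mul_one]⟩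

theorem P.mul (h : Alt R) {α β γ δ : ℤ} {x y : R} (hx : P e α β x) (hy : P e γ δ y) :
    P e (α + β - γ) (γ + δ - β) (x * y) := by
  have h1 := h.sw12 e x y
  have h2 := h.sw23 x y e
  unfold As at h1 h2
  rw [hx.1, hx.2, hy.1, smul_mul_assoc, smul_mul_assoc, mul_smul_comm] at h1
  rw [hx.2, hy.1, hy.2, smul_mul_assoc, mul_smul_comm, mul_smul_comm] at h2
  constructor
  · rw [sub_smul, add_smul]
    linear_combination (norm := abel) -h1
  · rw [sub_smul, add_smul]
    linear_combination (norm := abel) h2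

theorem P.l2 (h : Alt R) (he : e * e = e) {β : ℤ} {x : R} (hx : P e 2 β x) : x = 0 := by
  have h1 := h.l e x
  rw [he, hx.1, mul_smul_comm, hx.1] at h1
  apply h.tt
  linear_combination (norm := module) -h1

theorem P.lm (h : Alt R) (he : e * e = e) {β : ℤ} {x : R} (hx : P e (-1) β x) : x = 0 := by
  have h1 := h.l e x
  rw [he, hx.1, mul_smul_comm, hx.1] at h1
  apply h.tt
  linear_combination (norm := module) -h1

theorem P.r2 (h : Alt R) (he : e * e = e) {β : ℤ} {x : R} (hx : P e β 2 x) : x = 0 := by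
  have h1 := h.r e x
  rw [he, hx.2, smul_mul_assoc, hx.2] at h1
  apply h.tt
  linear_combination (norm := module) h1

theorem P.rm (h : Alt R) (he : e * e = e) {β : ℤ} {x : R} (hx : P e β (-1) x) : x = 0 := by
  have h1 := h.r e x
  rw [he, hx.2, smul_mul_assoc, hx.2] at h1
  apply h.tt
  linear_combination (norm := module) h1

theorem m11_11 (h : Alt R) {x y : R} (hx : P e 1 1 x) (hy : P e 1 1 y) :
    P e 1 1 (x * y) := by simpa using hx.mul h hy

theorem m11_12 (h : Alt R) {x y : R} (hx : P e 1 1 x) (hy : P e 1 0 y) :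
    P e 1 0 (x * y) := by simpa using hx.mul h hy

theorem m11_21 (h : Alt R) (he : e * e = e) {x y : R} (hx : P e 1 1 x) (hy : P e 0 1 y) :
    x * y = 0 := P.l2 h he (by simpa using hx.mul h hy)

theorem m11_22 (h : Alt R) (he : e * e = e) {x y : R} (hx : P e 1 1 x) (hy : P e 0 0 y) :
    x * y = 0 := P.l2 h he (by simpa using hx.mul h hy)

theorem m12_11 (h : Alt R) (he : e * e = e) {x y : R} (hx : P e 1 0 x) (hy : P e 1 1 y) :
    x * y = 0 := P.r2 h he (by simpa using hx.mul h hy)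

theorem m12_12 (h : Alt R) {x y : R} (hx : P e 1 0 x) (hy : P e 1 0 y) :
    P e 0 1 (x * y) := by simpa using hx.mul h hy

theorem m12_21 (h : Alt R) {x y : R} (hx : P e 1 0 x) (hy : P e 0 1 y) :
    P e 1 1 (x * y) := by simpa using hx.mul h hy

theorem m12_22 (h : Alt R) {x y : R} (hx : P e 1 0 x) (hy : P e 0 0 y) :
    P e 1 0 (x * y) := by simpa using hx.mul h hy

theorem m21_11 (h : Alt R) {x y : R} (hx : P e 0 1 x) (hy : P e 1 1 y) :
    P e 0 1 (x * y) := by simpa using hx.mul h hy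

theorem m21_12 (h : Alt R) {x y : R} (hx : P e 0 1 x) (hy : P e 1 0 y) :
    P e 0 0 (x * y) := by simpa using hx.mul h hy

theorem m21_21 (h : Alt R) {x y : R} (hx : P e 0 1 x) (hy : P e 0 1 y) :
    P e 1 0 (x * y) := by simpa using hx.mul h hy

theorem m21_22 (h : Alt R) (he : e * e = e) {x y : R} (hx : P e 0 1 x) (hy : P e 0 0 y) :
    x * y = 0 := P.rm h he (by simpa using hx.mul h hy)

theorem m22_11 (h : Alt R) (he : e * e = e) {x y : R} (hx : P e 0 0 x) (hy : P e 1 1 y) :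
    x * y = 0 := P.lm h he (by simpa using hx.mul h hy)

theorem m22_12 (h : Alt R) (he : e * e = e) {x y : R} (hx : P e 0 0 x) (hy : P e 1 0 y) :
    x * y = 0 := P.lm h he (by simpa using hx.mul h hy)

theorem m22_21 (h : Alt R) {x y : R} (hx : P e 0 0 x) (hy : P e 0 1 y) :
    P e 0 1 (x * y) := by simpa using hx.mul h hy

theorem m22_22 (h : Alt R) {x y : R} (hx : P e 0 0 x) (hy : P e 0 0 y) :
    P e 0 0 (x * y) := by simpa using hx.mul h hy


theorem sq12 (h : Alt R) {x : R} (hx : P e 1 0 x) : x * x = 0 := by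
  have h1 := (m12_12 h hx hx).1
  have h2 := h.sw12 e x x
  have h3 : As x e x = 0 := by
    unfold As; rw [hx.1, hx.2]; 
    have := h.l x e
    rw [hx.2] at this
    simp only [one_smul, zero_smul, zero_mul, mul_zero] at *
    have h4 := h.r x e
    simp [hx.1, h1] at h4
    simp [h4]
  unfold As at h2 h3
  rw [h3, hx.1, h1] at h2
  simpa using h2

/-- Components. -/
def c11 (e w : R) : R := e * (w * e)
def c12 (e w : R) : R := e * w - e * (w * e)
def c21 (e w : R) : R := w * e - e * (w * e)
def c22 (e w : R) : R := w - e * w - w * e + e * (w * e)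

theorem Alt.flex (h : Alt R) (e w : R) : e * w * e = e * (w * e) := by
  have h4 : As e w e = 0 := by rw [h.sw23, show As e e w = 0 by unfold As; rw [h.l, sub_self], neg_zero]
  exact sub_eq_zero.mp h4

theorem P11 (h : Alt R) (he : e * e = e) (w : R) : P e 1 1 (c11 e w) := by
  have h1 := h.l e (w * e)
  have h2 := h.flex e (w * e)
  have h3 := h.r e w
  rw [he] at h1 h3
  rw [h3] at h2
  simp [P, c11, ← h1, h2]

theorem P12 (h : Alt R) (he : e * e = e) (w : R) : P e 1 0 (c12 e w) := by
  have h1 := h.l e (w * e)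
  have h0 := h.l e w
  have h2 := h.flex e (w * e)
  have h4 := h.flex e w
  have h3 := h.r e w
  rw [he] at h1 h3 h0
  rw [h3] at h2
  simp [P, c12, mul_sub, sub_mul, ← h1, h2, ← h0, h4]

theorem P21 (h : Alt R) (he : e * e = e) (w : R) : P e 0 1 (c21 e w) := by
  have h1 := h.l e (w * e)
  have h0 := h.l e w
  have h2 := h.flex e (w * e)
  have h4 := h.flex e w
  have h3 := h.r e w
  rw [he] at h1 h3 h0
  rw [h3] at h2
  simp [P, c21, mul_sub, sub_mul, ← h1, h2, ← h0, h4, h3]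

theorem P22 (h : Alt R) (he : e * e = e) (w : R) : P e 0 0 (c22 e w) := by
  have h1 := h.l e (w * e)
  have h0 := h.l e w
  have h2 := h.flex e (w * e)
  have h4 := h.flex e w
  have h3 := h.r e w
  rw [he] at h1 h3 h0
  rw [h3] at h2
  simp [P, c22, mul_sub, sub_mul, mul_add, add_mul, ← h1, h2, ← h0, h4, h3]

theorem csum (e w : R) : w = c11 e w + c12 e w + c21 e w + c22 e w := by
  unfold c11 c12 c21 c22; abel

theorem dec (h : Alt R) (he : e * e = e) (w : R) : ∃ a x y b : R,
    P e 1 1 a ∧ P e 1 0 x ∧ P e 0 1 y ∧ P e 0 0 b ∧ w = a + x + y + b :=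
  ⟨_, _, _, _, P11 h he w, P12 h he w, P21 h he w, P22 h he w, csum e w⟩

theorem cval {a x y b : R} (ha : P e 1 1 a) (hx : P e 1 0 x) (hy : P e 0 1 y) (hb : P e 0 0 b) :
    c11 e (a + x + y + b) = a ∧ c12 e (a + x + y + b) = x ∧ c21 e (a + x + y + b) = y ∧
      c22 e (a + x + y + b) = b := by
  simp [c11, c12, c21, c22, add_mul, mul_add, ha.1, ha.2, hx.1, hx.2, hy.1, hy.2, hb.1, hb.2]
  abel

theorem ext4 {a x y b : R} (ha : P e 1 1 a) (hx : P e 1 0 x) (hy : P e 0 1 y) (hb : P e 0 0 b)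
    (h0 : a + x + y + b = 0) : a = 0 ∧ x = 0 ∧ y = 0 ∧ b = 0 := by
  have := cval ha hx hy hb
  rw [h0] at this
  simp [c11, c12, c21, c22] at this
  obtain ⟨h1, h2, h3, h4⟩ := this
  exact ⟨h1.symm, h2.symm, h3.symm, h4.symm⟩

/-- Commutator. -/
def br (x y : R) : R := x * y - y * x

theorem br_add (x y z : R) : br x (y + z) = br x y + br x z := by
  simp only [br, mul_add, add_mul]; abel
theorem add_br (x y z : R) : br (x + y) z = br x z + br y z := by
  simp only [br, mul_add, add_mul]; abel
theorem br_sub (x y z : R) : br x (y - z) = br x y - br x z := by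
  simp only [br, mul_sub, sub_mul]; abel
theorem sub_br (x y z : R) : br (x - y) z = br x z - br y z := by
  simp only [br, mul_sub, sub_mul]; abel
theorem br_neg (x y : R) : br x (- y) = - br x y := by
  simp only [br, mul_neg, neg_mul]; abel
theorem neg_br (x y : R) : br (-x) y = - br x y := by
  simp only [br, mul_neg, neg_mul]; abel
theorem br_zero (x : R) : br x 0 = 0 := by simp [br]
theorem zero_br (x : R) : br 0 x = 0 := by simp [br]
theorem br_anti (x y : R) : br x y = - br y x := by simp [br]
theorem Cen.br {z : R} (hz : Cen z) (x : R) : br z x = 0 := by simp [LieAlt.br, hz x]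
theorem Cen.br' {z : R} (hz : Cen z) (x : R) : LieAlt.br x z = 0 := by simp [LieAlt.br, hz x]
theorem cen_iff {z : R} : Cen z ↔ ∀ x, br z x = 0 := by simp [Cen, br, sub_eq_zero]
theorem Cen.add {z w : R} (hz : Cen z) (hw : Cen w) : Cen (z + w) := fun r => by
  rw [add_mul, mul_add, hz, hw]
theorem Cen.neg {z : R} (hz : Cen z) : Cen (-z) := fun r => by
  rw [neg_mul, mul_neg, hz]
theorem Cen.sub {z w : R} (hz : Cen z) (hw : Cen w) : Cen (z - w) := fun r => by
  rw [sub_mul, mul_sub, hz, hw]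
theorem br11 {x : R} (hx : P e 1 1 x) : br e x = 0 := by simp [br, hx.1, hx.2]
theorem br22 {x : R} (hx : P e 0 0 x) : br e x = 0 := by simp [br, hx.1, hx.2]
theorem br12 {x : R} (hx : P e 1 0 x) : br e x = x := by simp [br, hx.1, hx.2]
theorem br21 {x : R} (hx : P e 0 1 x) : br e x = -x := by simp [br, hx.1, hx.2]

theorem cen_of_parts (h : Alt R) (he : e * e = e) {q : R}
    (h11 : ∀ w, P e 1 1 w → br q w = 0) (h12 : ∀ w, P e 1 0 w → br q w = 0)
    (h21 : ∀ w, P e 0 1 w → br q w = 0) (h22 : ∀ w, P e 0 0 w → br q w = 0) : Cen q := by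
  rw [cen_iff]; intro w
  obtain ⟨a, x, y, b, ha, hx, hy, hb, rfl⟩ := dec h he w
  rw [br_add, br_add, br_add, h11 a ha, h12 x hx, h21 y hy, h22 b hb]; simp

theorem idem_key (h : Alt R) (he : e * e = e) {D : R → R}
    (hD : ∀ x y, D (br x y) = br (D x) y + br x (D y)) : Cen (D e - br e (br e (D e))) := by
  have D0 : D 0 = 0 := by have := hD 0 0; simpa [br] using this
  have key := hD e
  have key2 : ∀ w, D (br w e) = br (D w) e + br w (D e) := fun w => hD w e
  generalize D e = p at *
  obtain ⟨a, x, y, b, ha, hx, hy, hb, rfl⟩ := dec h he p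
  have hq : (a + x + y + b) - br e (br e (a + x + y + b)) = a + b := by
    simp only [br_add, br11 ha, br12 hx, br21 hy, br22 hb, br_zero, br_neg]; abel
  rw [hq]
  refine cen_of_parts h he ?_ ?_ ?_ ?_
  · intro w hw
    have k := key w
    obtain ⟨a', x', y', b', ha', hx', hy', hb', hv⟩ := dec h he (D w)
    rw [br11 hw, D0, hv] at k
    simp only [br_add, br11 ha', br12 hx', br21 hy', br22 hb'] at k
    have := (ext4 (a := br a w) (x := x' - w * x) (y := y * w - y') (b := 0)
      ((m11_11 h ha hw).sub (m11_11 h hw ha)) (hx'.sub (m11_12 h hw hx))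
      ((m21_11 h hy hw).sub hy') P.zero (by
        refine Eq.trans ?_ k.symm; simp only [br, add_mul, mul_add, m12_11 h he hx hw, m22_11 h he hb hw,
          m11_21 h he hw hy, m11_22 h he hw hb]; abel)).1
    rw [add_br, this]; simp [br, m22_11 h he hb hw, m11_22 h he hw hb]
  · intro w hw
    have k := key w
    obtain ⟨a', x', y', b', ha', hx', hy', hb', hv⟩ := dec h he (D w)
    rw [br12 hw, hv] at k
    simp only [br_add, br11 ha', br12 hx', br21 hy', br22 hb'] at k
    have := (ext4 (a := - (w * y) - a') (x := a * w - w * b) (y := x * w - w * x - y' - y')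
      (b := y * w - b')
      ((m12_21 h hw hy).neg.sub ha') ((m11_12 h ha hw).sub (m12_22 h hw hb))
      ((((m12_12 h hx hw).sub (m12_12 h hw hx)).sub hy').sub hy')
      ((m21_12 h hy hw).sub hb') (by
        rw [← sub_eq_zero] at k
        rw [← neg_eq_zero, ← k]; simp only [br, add_mul, mul_add, m22_12 h he hb hw,
          m12_11 h he hw ha]; abel)).2.1
    rw [add_br]; simpa [br, m22_12 h he hb hw, m12_11 h he hw ha, sub_eq_add_neg] using this
  · intro w hw
    have k := key2 w
    obtain ⟨a', x', y', b', ha', hx', hy', hb', hv⟩ := dec h he (D w)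
    rw [br_anti, br21 hw, neg_neg, hv, br_anti _ e] at k
    simp only [br_add, br11 ha', br12 hx', br21 hy', br22 hb'] at k
    have := (ext4 (a := - (x * w) - a') (x := w * y - y * w - x' - x') (y := w * a - b * w)
      (b := w * x - b')
      ((m12_21 h hx hw).neg.sub ha')
      ((((m21_21 h hw hy).sub (m21_21 h hy hw)).sub hx').sub hx')
      ((m21_11 h hw ha).sub (m22_21 h hb hw))
      ((m21_12 h hw hx).sub hb') (by
        rw [← sub_eq_zero] at k
        rw [← neg_eq_zero, ← k]; simp only [br, add_mul, mul_add, m21_22 h he hw hb,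
          m11_21 h he ha hw]; abel)).2.2.1
    rw [br_anti, neg_eq_zero, br_add]
    simpa [br, m21_22 h he hw hb, m11_21 h he ha hw, sub_eq_add_neg] using this
  · intro w hw
    have k := key w
    obtain ⟨a', x', y', b', ha', hx', hy', hb', hv⟩ := dec h he (D w)
    rw [br22 hw, D0, hv] at k
    simp only [br_add, br11 ha', br12 hx', br21 hy', br22 hb'] at k
    have := (ext4 (a := 0) (x := x * w + x') (y := - (w * y) - y') (b := br b w)
      P.zero ((m12_22 h hx hw).add hx')
      ((m22_21 h hw hy).neg.sub hy') ((m22_22 h hb hw).sub (m22_22 h hw hb)) (by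
        refine Eq.trans ?_ k.symm; simp only [br, add_mul, mul_add, m22_12 h he hw hx, m22_11 h he hw ha,
          m21_22 h he hy hw, m11_22 h he ha hw]; abel)).2.2.2
    rw [add_br, this]; simp [br, m22_11 h he hw ha, m11_22 h he ha hw]

end peirce

section ctx
variable {R : Type*} [NonAssocRing R]

theorem P.swap' {e : R} {α β : ℤ} {x : R} (hx : P (1 - e) α β x) : P e (1 - α) (1 - β) x := by
  simpa using hx.swap

theorem s11 {e x : R} : P (1 - e) 1 1 x ↔ P e 0 0 x :=
  ⟨fun h => by simpa using h.swap', fun h => by simpa using h.swap⟩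
theorem s12 {e x : R} : P (1 - e) 1 0 x ↔ P e 0 1 x :=
  ⟨fun h => by simpa using h.swap', fun h => by simpa using h.swap⟩
theorem s21 {e x : R} : P (1 - e) 0 1 x ↔ P e 1 0 x :=
  ⟨fun h => by simpa using h.swap', fun h => by simpa using h.swap⟩
theorem s22 {e x : R} : P (1 - e) 0 0 x ↔ P e 1 1 x :=
  ⟨fun h => by simpa using h.swap', fun h => by simpa using h.swap⟩

/-- The working context after normalisation. -/
structure Ctx (e : R) (D A B : R → R) : Prop where
  alt : Alt R
  he : e * e = e
  e0 : e ≠ 0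
  f0 : 1 - e ≠ 0
  h2 : ∀ x, P e 1 1 x → (∀ y, P e 1 0 y → x * y = 0) → x = 0
  h3 : ∀ x, P e 0 0 x → (∀ y, P e 0 1 y → x * y = 0) → x = 0
  h4 : ∀ z : R, Cen z → z ≠ 0 → ∀ y : R, ∃ x : R, z * x = y
  hD : ∀ x y, D (br x y) = br (D x) y + br x (D y)
  cE : Cen (D e)
  cF : Cen (D (1 - e))
  hA : ∀ a, P e 1 1 a → P e 1 1 (A a) ∧ Cen (D a - A a)
  hB : ∀ a, P e 0 0 a → P e 0 0 (B a) ∧ Cen (D a - B a)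

theorem Ctx.swap {e : R} {D A B : R → R} (C : Ctx e D A B) : Ctx (1 - e) D B A where
  alt := C.alt
  he := by simp [mul_sub, sub_mul, C.he]
  e0 := C.f0
  f0 := by simpa using C.e0
  h2 := by simpa only [s11, s12] using C.h3
  h3 := by simpa only [s22, s21] using C.h2
  h4 := C.h4
  hD := C.hD
  cE := C.cF
  cF := by simpa using C.cE
  hA := by simpa only [s11] using C.hB
  hB := by simpa only [s22] using C.hA

variable {e : R} {D A B : R → R}

theorem anti12 (h : Alt R) {x y : R} (hx : P e 1 0 x) (hy : P e 1 0 y) : y * x = - (x * y) := by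
  have h1 := sq12 h (hx.add hy)
  simp only [mul_add, add_mul, sq12 h hx, sq12 h hy] at h1
  linear_combination (norm := abel) h1

namespace Ctx

theorem D0 (C : Ctx e D A B) : D 0 = 0 := by
  have := C.hD 0 0
  simpa [br] using this

theorem De (C : Ctx e D A B) (w : R) : D (br e w) = br e (D w) := by
  rw [C.hD, C.cE.br, zero_add]

theorem De' (C : Ctx e D A B) (w : R) : D (br w e) = br (D w) e := by
  rw [C.hD, C.cE.br', add_zero]

theorem D12 (C : Ctx e D A B) {x : R} (hx : P e 1 0 x) : P e 1 0 (D x) := by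
  have k := C.De x
  obtain ⟨a', x', y', b', ha', hx', hy', hb', hv⟩ := dec C.alt C.he (D x)
  rw [br12 hx, hv] at k
  simp only [br_add, br11 ha', br12 hx', br21 hy', br22 hb'] at k
  obtain ⟨ra, -, ry, rb⟩ := ext4 (a := a') (x := 0) (y := y' + y') (b := b') ha' P.zero
    (hy'.add hy') hb' (by linear_combination (norm := abel) k)
  rw [hv, ra, C.alt.tt ry, rb]; simpa using hx'

theorem D21 (C : Ctx e D A B) {x : R} (hx : P e 0 1 x) : P e 0 1 (D x) :=
  s12.mp (C.swap.D12 (s12.mpr hx))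

theorem neg12 (C : Ctx e D A B) {x : R} (hx : P e 1 0 x) : D (-x) = - D x := by
  have k := C.De' x
  rw [br_anti, br12 hx, br_anti, br12 (C.D12 hx)] at k
  exact k

theorem neg21 (C : Ctx e D A B) {x : R} (hx : P e 0 1 x) : D (-x) = - D x :=
  C.swap.neg12 (s12.mpr hx)

theorem diag (C : Ctx e D A B) {q : R} (h : br e q = 0) :
    ∃ a b, P e 1 1 a ∧ P e 0 0 b ∧ q = a + b := by
  obtain ⟨a', x', y', b', ha', hx', hy', hb', rfl⟩ := dec C.alt C.he q
  simp only [br_add, br11 ha', br12 hx', br21 hy', br22 hb'] at h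
  obtain ⟨-, rx, ry, -⟩ := ext4 (a := 0) (x := x') (y := -y') (b := 0) P.zero hx'
    hy'.neg P.zero (by linear_combination (norm := abel) h)
  exact ⟨a', b', ha', hb', by rw [rx, neg_eq_zero.mp ry]; abel⟩

theorem idem (C : Ctx e D A B) {x : R} (hx : P e 1 0 x) : Cen (D (e + x) - D x) := by
  have h := C.alt
  have he := C.he
  have hdx := C.D12 hx
  have hee : br e e = 0 := by simp [br]
  have k1 := C.De (e + x)
  rw [br_add, hee, zero_add, br12 hx] at k1
  obtain ⟨a, b, ha, hb, hq⟩ := C.diag (q := D (e + x) - D x) (by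
    rw [br_sub, ← k1, br12 hdx, sub_self])
  rw [hq]
  have hg : (e + x) * (e + x) = e + x := by
    rw [mul_add, add_mul, add_mul, he, hx.1, hx.2, sq12 h hx]; simp
  have key := idem_key h hg C.hD
  have hp : D (e + x) = a + b + D x := by rw [← hq]; abel
  rw [hp] at key
  generalize D x = d at *
  have hu : P e 1 0 (x * b - a * x) := (m12_22 h hx hb).sub (m11_12 h ha hx)
  have e1 : br (e + x) (a + b + d) = d + (x * b - a * x) + (x * d + x * d) := by
    rw [add_br, br_add, br_add, br11 ha, br22 hb, br12 hdx, br, mul_add, mul_add, add_mul, add_mul,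
      m12_11 h he hx ha, m22_12 h he hb hx, anti12 h hx hdx]
    abel
  have hxd := m12_12 h hx hdx
  have l1 : x * (x * d) = 0 := by rw [← h.l, sq12 h hx, zero_mul]
  have l2 : (x * d) * x = 0 := by
    rw [show x * d = - (d * x) by rw [anti12 h hx hdx, neg_neg], neg_mul, h.r, sq12 h hx]; simp
  have e2 : br (e + x) (d + (x * b - a * x) + (x * d + x * d))
      = d + (x * b - a * x) + br x (x * b - a * x) := by
    generalize x * b - a * x = u at *
    rw [add_br, br_add, br_add, br12 hdx, br12 hu, br21 (hxd.add hxd), br_add, br_add,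
      show br x d = x * d + x * d by rw [br, anti12 h hx hdx]; abel,
      show br x (x * d + x * d) = 0 by rw [br, mul_add, add_mul, l1, l2]; abel]
    abel
  rw [e1, e2] at key
  generalize x * b - a * x = u at *
  have hxu : P e 0 1 (br x u) := (m12_12 h hx hu).sub (m12_12 h hu hx)
  have hz := key.br' e
  rw [br_sub, br_add, br_add, br_add, br_add, br11 ha, br22 hb, br12 hdx, br12 hu, br21 hxu] at hz
  obtain ⟨-, r1, r2, -⟩ := ext4 (a := 0) (x := u) (y := - br x u) (b := 0) P.zero hu
    hxu.neg P.zero (by linear_combination (norm := abel) - hz)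
  rw [neg_eq_zero.mp r2, r1] at key
  simpa using key

theorem comp (C : Ctx e D A B) (g : R) : Cen (D (1 - g) + D g) := by
  rw [cen_iff]; intro w
  have h1 : br (1 - g) w = br w g := by simp [br, sub_mul, mul_sub]
  have h2 : br (1 - g) (D w) = br (D w) g := by simp [br, sub_mul, mul_sub]
  have k := C.hD (1 - g) w
  rw [h1, C.hD, h2] at k
  rw [add_br, br_anti (D g) w]
  linear_combination (norm := abel) - k

theorem idem' (C : Ctx e D A B) {x : R} (hx : P e 1 0 x) : Cen (D (1 - e + x) - D x) := by
  have h1 := C.idem hx.neg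
  have h2 := C.comp (e + -x)
  rw [C.neg12 hx] at h1
  have := h2.sub h1
  rw [show 1 - e + x = 1 - (e + -x) by abel]
  convert this using 1
  abel

theorem addx (C : Ctx e D A B) {x y : R} (hx : P e 1 0 x) (hy : P e 0 1 y) :
    D (x + y) = D x + D y := by
  have h := C.alt
  have c1 := C.idem hx
  have c2 := C.swap.idem (s12.mpr hy)
  have hdx := C.D12 hx
  have hdy := C.D21 hy
  have hd : ∀ x y, P e 1 0 x → P e 0 1 y → br e (br x y) = 0 := fun x y hx hy => by
    change br e (x * y - y * x) = 0
    rw [br_sub, br11 (m12_21 h hx hy), br22 (m21_12 h hy hx), sub_zero]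
  have hf : ∀ x, P e 1 0 x → br x (1 - e) = x := fun x hx => by
    simp [br, mul_sub, sub_mul, hx.1, hx.2]
  have hfe : br e (1 - e) = 0 := by simp [br, mul_sub, sub_mul]
  have e1 : br e (br (e + x) (1 - e + y)) = x + y := by
    simp only [add_br, br_add, hfe, br21 hy, hf x hx, hd x y hx hy, br12 hx, br_neg, br_zero]
    abel
  obtain ⟨z, hz, rz⟩ : ∃ z, Cen z ∧ D (e + x) = D x + z := ⟨_, c1, by abel⟩
  obtain ⟨z', hz', rz'⟩ : ∃ z, Cen z ∧ D (1 - e + y) = D y + z := ⟨_, c2, by abel⟩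
  rw [← e1, C.De, C.hD, rz, rz', add_br (D x), hz.br, br_add (e + x), hz'.br', add_zero, add_zero]
  rw [add_br, br_add, br_add, br_add, br_add, hd _ _ hdx hy, hd _ _ hx hdy, br21 hdy, hf _ hdx,
    br12 hdx, br_neg, br21 hdy]
  abel

theorem add12 (C : Ctx e D A B) {x y : R} (hx : P e 1 0 x) (hy : P e 1 0 y) :
    D (x + y) = D x + D y := by
  have h := C.alt
  have c1 := C.idem hx
  have c2 := C.idem' hy
  have hdx := C.D12 hx
  have hdy := C.D12 hy
  have hd : ∀ x y, P e 1 0 x → P e 1 0 y → P e 0 1 (br x y) := fun x y hx hy =>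
    (m12_12 h hx hy).sub (m12_12 h hy hx)
  have hf : ∀ x, P e 1 0 x → br x (1 - e) = x := fun x hx => by
    simp [br, mul_sub, sub_mul, hx.1, hx.2]
  have hfe : br e (1 - e) = 0 := by simp [br, mul_sub, sub_mul]
  have e1 : br (e + x) (1 - e + y) = (x + y) + br x y := by
    rw [add_br, br_add, br_add, hfe, br12 hy, hf x hx]
    abel
  obtain ⟨z, hz, rz⟩ : ∃ z, Cen z ∧ D (e + x) = D x + z := ⟨_, c1, by abel⟩
  obtain ⟨z', hz', rz'⟩ : ∃ z, Cen z ∧ D (1 - e + y) = D y + z := ⟨_, c2, by abel⟩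
  have k := C.hD (e + x) (1 - e + y)
  rw [e1, C.addx (hx.add hy) (hd x y hx hy), rz, rz', add_br (D x), hz.br, br_add (e + x), hz'.br',
    add_zero, add_zero, add_br, br_add, br12 hdy, hf _ hdx] at k
  have := (ext4 (a := 0) (x := D (x + y) - D x - D y) (y := D (br x y) - br (D x) y - br x (D y))
    (b := 0) P.zero (((C.D12 (hx.add hy)).sub hdx).sub hdy)
    (((C.D21 (hd x y hx hy)).sub (hd _ _ hdx hy)).sub (hd _ _ hx hdy)) P.zero (by
      linear_combination (norm := abel) k)).2.1
  linear_combination (norm := abel) this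

theorem add21 (C : Ctx e D A B) {x y : R} (hx : P e 0 1 x) (hy : P e 0 1 y) :
    D (x + y) = D x + D y := C.swap.add12 (s12.mpr hx) (s12.mpr hy)

theorem sub12 (C : Ctx e D A B) {x y : R} (hx : P e 1 0 x) (hy : P e 1 0 y) :
    D (x - y) = D x - D y := by
  rw [sub_eq_add_neg, C.add12 hx hy.neg, C.neg12 hy, sub_eq_add_neg]

theorem DA (C : Ctx e D A B) {a : R} (ha : P e 1 1 a) (w : R) : br (D a) w = br (A a) w := by
  have := (C.hA a ha).2.br w
  rw [sub_br] at this
  exact sub_eq_zero.mp this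

theorem m1112 (C : Ctx e D A B) {a t : R} (ha : P e 1 1 a) (ht : P e 1 0 t) :
    D (a * t) = A a * t + a * D t := by
  have k := C.hD a t
  rw [C.DA ha] at k
  simpa [br, m12_11 C.alt C.he ht ha, m12_11 C.alt C.he ht (C.hA a ha).1,
    m12_11 C.alt C.he (C.D12 ht) ha] using k

theorem m2111 (C : Ctx e D A B) {a t : R} (ha : P e 1 1 a) (ht : P e 0 1 t) :
    D (t * a) = D t * a + t * A a := by
  have k := C.hD t a
  rw [br_anti t (D a), C.DA ha, ← br_anti] at k
  simpa [br, m11_21 C.alt C.he ha ht, m11_21 C.alt C.he (C.hA a ha).1 ht,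
    m11_21 C.alt C.he ha (C.D21 ht)] using k

theorem m2221 (C : Ctx e D A B) {a t : R} (ha : P e 0 0 a) (ht : P e 0 1 t) :
    D (a * t) = B a * t + a * D t := C.swap.m1112 (s11.mpr ha) (s12.mpr ht)

theorem m1222 (C : Ctx e D A B) {a t : R} (ha : P e 0 0 a) (ht : P e 1 0 t) :
    D (t * a) = D t * a + t * B a := C.swap.m2111 (s11.mpr ha) (s21.mpr ht)

theorem m1212 (C : Ctx e D A B) {x y : R} (hx : P e 1 0 x) (hy : P e 1 0 y) :
    D (x * y) = D x * y + x * D y := by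
  have h := C.alt
  have k := C.hD x y
  have hxy := m12_12 h hx hy
  simp only [br] at k
  rw [anti12 h hx hy, anti12 h (C.D12 hx) hy, anti12 h hx (C.D12 hy), sub_neg_eq_add,
    C.add21 hxy hxy] at k
  rw [← sub_eq_zero]
  apply h.tt
  linear_combination (norm := abel) k

theorem m2121 (C : Ctx e D A B) {x y : R} (hx : P e 0 1 x) (hy : P e 0 1 y) :
    D (x * y) = D x * y + x * D y := C.swap.m1212 (s12.mpr hx) (s12.mpr hy)

theorem Aadd (C : Ctx e D A B) {a b : R} (ha : P e 1 1 a) (hb : P e 1 1 b) :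
    A (a + b) = A a + A b := by
  have pA := fun a ha => (C.hA a ha).1
  rw [← sub_eq_zero]
  apply C.h2 _ ((pA _ (ha.add hb)).sub ((pA _ ha).add (pA _ hb)))
  intro t ht
  have k := C.m1112 (ha.add hb) ht
  rw [add_mul, C.add12 (m11_12 C.alt ha ht) (m11_12 C.alt hb ht), C.m1112 ha ht, C.m1112 hb ht,
    add_mul] at k
  rw [sub_mul, add_mul]
  linear_combination (norm := abel) -k

theorem Badd (C : Ctx e D A B) {a b : R} (ha : P e 0 0 a) (hb : P e 0 0 b) :
    B (a + b) = B a + B b := C.swap.Aadd (s11.mpr ha) (s11.mpr hb)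

theorem as1 (C : Ctx e D A B) {a b t : R} (ha : P e 1 1 a) (hb : P e 1 1 b) (ht : P e 1 0 t) :
    a * b * t = a * (b * t) := by
  have h1 := C.alt.sw23 a b t
  have h2 := m12_11 C.alt C.he (m11_12 C.alt ha ht) hb
  have h3 := m12_11 C.alt C.he ht hb
  unfold As at h1
  rw [h2, h3] at h1
  simpa [sub_eq_zero] using h1

theorem as2 (C : Ctx e D A B) {a b t : R} (ha : P e 1 1 a) (hb : P e 0 0 b) (ht : P e 1 0 t) :
    a * t * b = a * (t * b) := by
  have h1 := C.alt.sw23 a t b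
  have h2 := m11_22 C.alt C.he ha hb
  have h3 := m22_12 C.alt C.he hb ht
  unfold As at h1
  rw [h2, h3] at h1
  simpa [sub_eq_zero] using h1

theorem Amul (C : Ctx e D A B) {a b : R} (ha : P e 1 1 a) (hb : P e 1 1 b) :
    A (a * b) = A a * b + a * A b := by
  have pA := fun a ha => (C.hA a ha).1
  have h := C.alt
  rw [← sub_eq_zero]
  apply C.h2 _ ((pA _ (m11_11 h ha hb)).sub ((m11_11 h (pA _ ha) hb).add (m11_11 h ha (pA _ hb))))
  intro t ht
  have k := C.m1112 (m11_11 h ha hb) ht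
  rw [C.as1 ha hb ht, C.m1112 ha (m11_12 h hb ht), C.m1112 hb ht, mul_add,
    C.as1 ha hb (C.D12 ht)] at k
  rw [sub_mul, add_mul, C.as1 (pA _ ha) hb ht, C.as1 ha (pA _ hb) ht]
  linear_combination (norm := abel) -k

theorem Bmul (C : Ctx e D A B) {a b : R} (ha : P e 0 0 a) (hb : P e 0 0 b) :
    B (a * b) = B a * b + a * B b := C.swap.Amul (s11.mpr ha) (s11.mpr hb)

theorem tau_e (C : Ctx e D A B) {a x y b : R} (ha : P e 1 1 a) (hx : P e 1 0 x) (hy : P e 0 1 y)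
    (hb : P e 0 0 b) : br e (D (a + x + y + b) - (A a + D x + D y + B b)) = 0 := by
  have pa := (C.hA a ha).1
  have pb := (C.hB b hb).1
  rw [br_sub, ← C.De]
  simp only [br_add, br11 ha, br12 hx, br21 hy, br22 hb, br11 pa, br22 pb, br12 (C.D12 hx),
    br21 (C.D21 hy), zero_add, add_zero]
  rw [C.addx hx hy.neg, C.neg21 hy, sub_self]

theorem tau12 (C : Ctx e D A B) {a x y b : R} (ha : P e 1 1 a) (hx : P e 1 0 x) (hy : P e 0 1 y)
    (hb : P e 0 0 b) {c : R} (hc : P e 1 0 c) :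
    br (D (a + x + y + b) - (A a + D x + D y + B b)) c = 0 := by
  have h := C.alt
  have he := C.he
  obtain ⟨p, q, hp, hq, hu⟩ := C.diag (C.tau_e ha hx hy hb)
  -- a general expansion
  have gen : ∀ a x y b c : R, P e 1 1 a → P e 1 0 x → P e 0 1 y → P e 0 0 b → P e 1 0 c →
      br e (br (a + x + y + b) c) = (a * c - c * b) + - (x * c + x * c) := by
    intro a x y b c ha hx hy hb hc
    have : br (a + x + y + b) c = (a * c - c * b) + (x * c + x * c) + y * c - c * y := by
      simp only [br, add_mul, mul_add, m12_11 h he hc ha, m22_12 h he hb hc, anti12 h hx hc]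
      abel
    have hxc := m12_12 h hx hc
    rw [this, br_sub, br_add, br_add, br11 (m12_21 h hc hy), br22 (m21_12 h hy hc),
      br12 ((m11_12 h ha hc).sub (m12_22 h hc hb)), br21 (hxc.add hxc)]
    abel
  have h1 : br (p + q) c = p * c - c * q := by
    simp [br, add_mul, mul_add, m12_11 h he hc hp, m22_12 h he hq hc]
  have h2 : br e (br (p + q) c) = br (p + q) c := by
    rw [h1]; exact br12 ((m11_12 h hp hc).sub (m12_22 h hc hq))
  rw [hu, ← h2, ← hu, sub_br, br_sub]
  have k := C.hD (a + x + y + b) c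
  have k2 : br (D (a + x + y + b)) c = D (br (a + x + y + b) c) - br (a + x + y + b) (D c) := by
    rw [k]; abel
  have hxc := m12_12 h hx hc
  rw [k2, br_sub, ← C.De, gen a x y b _ ha hx hy hb hc, gen a x y b _ ha hx hy hb (C.D12 hc),
    gen _ _ _ _ c (C.hA a ha).1 (C.D12 hx) (C.D21 hy) (C.hB b hb).1 hc,
    C.addx ((m11_12 h ha hc).sub (m12_22 h hc hb)) (hxc.add hxc).neg, C.neg21 (hxc.add hxc),
    C.add21 hxc hxc, C.m1212 hx hc, C.sub12 (m11_12 h ha hc) (m12_22 h hc hb), C.m1112 ha hc,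
    C.m1222 hb hc]
  abel

theorem tau21 (C : Ctx e D A B) {a x y b : R} (ha : P e 1 1 a) (hx : P e 1 0 x) (hy : P e 0 1 y)
    (hb : P e 0 0 b) {c : R} (hc : P e 0 1 c) :
    br (D (a + x + y + b) - (A a + D x + D y + B b)) c = 0 := by
  have := C.swap.tau12 (s11.mpr hb) (s12.mpr hy) (s21.mpr hx) (s22.mpr ha) (s12.mpr hc)
  rw [show b + y + x + a = a + x + y + b by abel,
    show B b + D y + D x + A a = A a + D x + D y + B b by abel] at this
  exact this

theorem comm11 (C : Ctx e D A B) {p q : R} (hp : P e 1 1 p) (hq : P e 0 0 q)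
    (hc : ∀ c, P e 1 0 c → br (p + q) c = 0) {a : R} (ha : P e 1 1 a) : br (p + q) a = 0 := by
  have h := C.alt
  have he := C.he
  have h1 : ∀ c, P e 1 0 c → p * c = c * q := fun c hc' => by
    have := hc c hc'
    simp [br, add_mul, mul_add, m12_11 h he hc' hp, m22_12 h he hq hc'] at this
    exact sub_eq_zero.mp this
  have h2 : br (p + q) a = p * a - a * p := by
    simp [br, add_mul, mul_add, m22_11 h he hq ha, m11_22 h he ha hq]
  rw [h2]
  apply C.h2 _ ((m11_11 h hp ha).sub (m11_11 h ha hp))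
  intro t ht
  rw [sub_mul, C.as1 hp ha ht, C.as1 ha hp ht, h1 t ht, h1 _ (m11_12 h ha ht), C.as2 ha hq ht,
    sub_self]

theorem tau_cen (C : Ctx e D A B) {a x y b : R} (ha : P e 1 1 a) (hx : P e 1 0 x) (hy : P e 0 1 y)
    (hb : P e 0 0 b) : Cen (D (a + x + y + b) - (A a + D x + D y + B b)) := by
  have t1 := fun c hc => C.tau12 ha hx hy hb (c := c) hc
  have t2 := fun c hc => C.tau21 ha hx hy hb (c := c) hc
  obtain ⟨p, q, hp, hq, hu⟩ := C.diag (C.tau_e ha hx hy hb)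
  simp only [hu] at t1 t2
  rw [hu]
  refine cen_of_parts C.alt C.he (fun w hw => C.comm11 hp hq t1 hw) t1 t2 (fun w hw => ?_)
  have := C.swap.comm11 (s11.mpr hq) (s22.mpr hp) (by
    intro c hc; rw [add_comm]; exact t2 c (s12.mp hc)) (s11.mpr hw)
  rw [add_comm]; exact this

theorem m1221both (C : Ctx e D A B) {x y : R} (hx : P e 1 0 x) (hy : P e 0 1 y) :
    A (x * y) = D x * y + x * D y := by
  have h := C.alt
  have he := C.he
  have hxy := m12_21 h hx hy
  have hyx := m21_12 h hy hx
  have pA := (C.hA _ hxy).1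
  have pB := (C.hB _ hyx).1
  have hdx := C.D12 hx
  have hdy := C.D21 hy
  have B0 : B 0 = 0 := by simpa using C.Badd (a := 0) (b := 0) P.zero P.zero
  have Bneg : B (-(y * x)) = - B (y * x) := by
    have := C.Badd hyx hyx.neg
    rw [add_neg_cancel, B0] at this
    linear_combination (norm := abel) -this
  have cz := C.tau_cen hxy P.zero P.zero hyx.neg
  have e0 : x * y + 0 + 0 + -(y * x) = br x y := by rw [br]; abel
  rw [e0, C.hD, C.D0, Bneg] at cz
  obtain ⟨z, rz⟩ : ∃ z, z = br (D x) y + br x (D y) - (A (x * y) + 0 + 0 + -B (y * x)) := ⟨_, rfl⟩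
  rw [← rz] at cz
  have rz2 : z = (D x * y + x * D y - A (x * y)) + (B (y * x) - (D y * x + y * D x)) := by
    rw [rz, br, br]; abel
  have hE : P e 1 1 (D x * y + x * D y - A (x * y)) :=
    ((m12_21 h hdx hy).add (m12_21 h hx hdy)).sub pA
  have hF : P e 0 0 (B (y * x) - (D y * x + y * D x)) :=
    pB.sub ((m21_12 h hdy hx).add (m21_12 h hy hdx))
  -- the flexible law
  have hfl : As x y (D x) = - As (D x) y x := h.sw13 _ _ _
  have hfl2 : As x (D y) x = 0 := sub_eq_zero.mpr (h.flex _ _)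
  have k1 := C.m1112 hxy hx
  have k2 := C.m1222 hyx hx
  rw [h.flex, k2] at k1
  have k3 : (D x * y + x * D y - A (x * y)) * x = - (x * (B (y * x) - (D y * x + y * D x))) := by
    unfold As at hfl hfl2
    simp only [sub_mul, add_mul, mul_sub, mul_add]
    linear_combination (norm := abel) k1 + hfl2 + hfl
  have zx : z * x = 0 := by
    have z1 : z * x = (D x * y + x * D y - A (x * y)) * x := by
      rw [rz2, add_mul _ _ x, m22_12 h he hF hx, add_zero]
    have z2 : x * z = x * (B (y * x) - (D y * x + y * D x)) := by
      rw [rz2, mul_add x, m12_11 h he hx hE, zero_add]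
    have z3 := cz x
    apply h.tt
    nth_rewrite 2 [z3]
    rw [z1, z2, k3, neg_add_cancel]
  by_cases hz : z = 0
  · rw [hz] at rz2
    have := (ext4 hE P.zero P.zero hF (by rw [add_zero, add_zero]; exact rz2.symm)).1
    exact (sub_eq_zero.mp this).symm
  · exfalso
    obtain ⟨c, hc⟩ := C.h4 z cz hz 1
    have hx0 : x = 0 := by
      have : As c z x = 0 := by rw [h.sw12, h.nuc cz, neg_zero]
      unfold As at this
      rw [← cz c, hc, zx, one_mul, mul_zero, sub_zero] at this
      exact this
    have A0 : A 0 = 0 := by simpa using C.Aadd (a := 0) (b := 0) P.zero P.zero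
    apply hz
    rw [rz2, hx0]; simp [A0, B0, C.D0]

theorem m1221 (C : Ctx e D A B) {x y : R} (hx : P e 1 0 x) (hy : P e 0 1 y) :
    A (x * y) = D x * y + x * D y := C.m1221both hx hy

theorem m2112 (C : Ctx e D A B) {x y : R} (hx : P e 1 0 x) (hy : P e 0 1 y) :
    B (y * x) = D y * x + y * D x := C.swap.m1221both (s12.mpr hy) (s21.mpr hx)

theorem main (C : Ctx e D A B) : ∃ δ : R → R, (∀ x y, δ (x + y) = δ x + δ y) ∧
    (∀ x y, δ (x * y) = δ x * y + x * δ y) ∧ ∀ x, Cen (D x - δ x) := by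
  have h := C.alt
  have he := C.he
  obtain ⟨δ, hδ⟩ : ∃ δ : R → R, ∀ w, δ w = A (c11 e w) + D (c12 e w) + D (c21 e w) + B (c22 e w) :=
    ⟨_, fun _ => rfl⟩
  have val : ∀ a x y b, P e 1 1 a → P e 1 0 x → P e 0 1 y → P e 0 0 b →
      δ (a + x + y + b) = A a + D x + D y + B b := by
    intro a x y b ha hx hy hb
    obtain ⟨r1, r2, r3, r4⟩ := cval ha hx hy hb
    rw [hδ, r1, r2, r3, r4]
  refine ⟨δ, ?_, ?_, ?_⟩
  · intro v w
    obtain ⟨a, x, y, b, ha, hx, hy, hb, rfl⟩ := dec h he v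
    obtain ⟨a', x', y', b', ha', hx', hy', hb', rfl⟩ := dec h he w
    rw [show a + x + y + b + (a' + x' + y' + b') = (a + a') + (x + x') + (y + y') + (b + b') by abel,
      val _ _ _ _ (ha.add ha') (hx.add hx') (hy.add hy') (hb.add hb'), val _ _ _ _ ha hx hy hb,
      val _ _ _ _ ha' hx' hy' hb', C.Aadd ha ha', C.add12 hx hx', C.add21 hy hy', C.Badd hb hb']
    abel
  · intro v w
    obtain ⟨a, x, y, b, ha, hx, hy, hb, rfl⟩ := dec h he v
    obtain ⟨a', x', y', b', ha', hx', hy', hb', rfl⟩ := dec h he w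
    have ex : ∀ a x y b a' x' y' b' : R, P e 1 1 a → P e 1 0 x → P e 0 1 y → P e 0 0 b →
        P e 1 1 a' → P e 1 0 x' → P e 0 1 y' → P e 0 0 b' →
        (a + x + y + b) * (a' + x' + y' + b') = (a * a' + x * y') + (a * x' + x * b' + y * y')
          + (y * a' + b * y' + x * x') + (y * x' + b * b') := by
      intro a x y b a' x' y' b' ha hx hy hb ha' hx' hy' hb'
      simp only [mul_add, add_mul, m11_21 h he ha hy', m11_22 h he ha hb', m12_11 h he hx ha',
        m21_22 h he hy hb', m22_11 h he hb ha', m22_12 h he hb hx']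
      abel
    have pa := (C.hA _ ha).1
    have pa' := (C.hA _ ha').1
    have pb := (C.hB _ hb).1
    have pb' := (C.hB _ hb').1
    have px := C.D12 hx
    have px' := C.D12 hx'
    have py := C.D21 hy
    have py' := C.D21 hy'
    rw [val _ _ _ _ ha hx hy hb, val _ _ _ _ ha' hx' hy' hb',
      ex _ _ _ _ _ _ _ _ ha hx hy hb ha' hx' hy' hb', ex _ _ _ _ _ _ _ _ pa px py pb ha' hx' hy' hb',
      ex _ _ _ _ _ _ _ _ ha hx hy hb pa' px' py' pb',
      val _ _ _ _ ((m11_11 h ha ha').add (m12_21 h hx hy'))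
        (((m11_12 h ha hx').add (m12_22 h hx hb')).add (m21_21 h hy hy'))
        (((m21_11 h hy ha').add (m22_21 h hb hy')).add (m12_12 h hx hx'))
        ((m21_12 h hy hx').add (m22_22 h hb hb')),
      C.Aadd (m11_11 h ha ha') (m12_21 h hx hy'),
      C.add12 ((m11_12 h ha hx').add (m12_22 h hx hb')) (m21_21 h hy hy'),
      C.add12 (m11_12 h ha hx') (m12_22 h hx hb'),
      C.add21 ((m21_11 h hy ha').add (m22_21 h hb hy')) (m12_12 h hx hx'),
      C.add21 (m21_11 h hy ha') (m22_21 h hb hy'),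
      C.Badd (m21_12 h hy hx') (m22_22 h hb hb'),
      C.Amul ha ha', C.m1221 hx hy', C.m1112 ha hx', C.m1222 hb' hx, C.m2121 hy hy',
      C.m2111 ha' hy, C.m2221 hb hy', C.m1212 hx hx', C.m2112 hx' hy, C.Bmul hb hb']
    abel
  · intro w
    obtain ⟨a, x, y, b, ha, hx, hy, hb, rfl⟩ := dec h he w
    rw [val _ _ _ _ ha hx hy hb]
    exact C.tau_cen ha hx hy hb

end Ctx
end ctx

section final
variable {R : Type*} [NonAssocRing R]

theorem mem00 (h : Alt R) {e : R} (he : e * e = e) {x : R} : x ∈ peirceSet e 0 0 ↔ P e 1 1 x := by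
  constructor
  · rintro ⟨a, rfl⟩; exact P11 h he a
  · intro hx; exact ⟨x, by simp [peirceE, hx.1, hx.2]⟩

theorem mem01 (h : Alt R) {e : R} (he : e * e = e) {x : R} : x ∈ peirceSet e 0 1 ↔ P e 1 0 x := by
  constructor
  · rintro ⟨a, rfl⟩
    have := P12 h he a
    simpa [peirceE, c12, mul_sub] using this
  · intro hx; exact ⟨x, by simp [peirceE, hx.1, hx.2, mul_sub]⟩

theorem mem10 (h : Alt R) {e : R} (he : e * e = e) {x : R} : x ∈ peirceSet e 1 0 ↔ P e 0 1 x := by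
  constructor
  · rintro ⟨a, rfl⟩
    have := P21 h he a
    simpa [peirceE, c21, sub_mul] using this
  · intro hx; exact ⟨x, by simp [peirceE, hx.1, hx.2, sub_mul]⟩

theorem c22_eq (e a : R) : (1 - e) * (a * (1 - e)) = c22 e a := by
  simp only [c22, mul_sub, sub_mul, one_mul, mul_one]; abel

theorem mem11 (h : Alt R) {e : R} (he : e * e = e) {x : R} : x ∈ peirceSet e 1 1 ↔ P e 0 0 x := by
  constructor
  · rintro ⟨a, rfl⟩
    have := P22 h he a
    rw [← c22_eq] at this
    simpa [peirceE] using this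
  · intro hx; exact ⟨x, by simp [peirceE, hx.1, hx.2, sub_mul, mul_sub]⟩

theorem der_comp (h : Alt R) {e : R} (he : e * e = e) {δ : R → R}
    (hadd : ∀ x y, δ (x + y) = δ x + δ y)
    (hδ : ∀ x y : R, δ (x * y) = δ x * y + x * δ y) :
    (∀ a, P e 1 1 a → c22 e (δ a) = 0) ∧ (∀ b, P e 0 0 b → c11 e (δ b) = 0) := by
  have d0 : δ 0 = 0 := by simpa using hadd 0 0
  have k := hδ e e
  have hl := fun w => hδ e w
  rw [he] at k
  generalize δ e = s at *
  obtain ⟨p, x, y, q, hp, hx, hy, hq, rfl⟩ := dec h he s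
  simp only [mul_add, add_mul, hp.1, hp.2, hx.1, hx.2, hy.1, hy.2, hq.1, hq.2, one_smul,
    zero_smul] at k
  obtain ⟨r1, -, -, r4⟩ := ext4 (a := p) (x := 0) (y := 0) (b := -q) hp P.zero P.zero hq.neg
    (by linear_combination (norm := abel) -k)
  rw [neg_eq_zero] at r4
  subst r1 r4
  constructor
  · intro a ha
    have k := hl a
    rw [ha.1, one_smul] at k
    generalize δ a = v at *
    obtain ⟨p', x', y', q', hp', hx', hy', hq', rfl⟩ := dec h he v
    rw [(cval hp' hx' hy' hq').2.2.2]
    simp only [mul_add, add_mul, hp'.1, hx'.1, hy'.1, hq'.1, one_smul, zero_smul, zero_mul,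
      m12_11 h he hx ha] at k
    exact (ext4 (a := 0) (x := 0) (y := y' - y * a) P.zero P.zero (hy'.sub (m21_11 h hy ha)) hq'
      (by linear_combination (norm := abel) k)).2.2.2
  · intro a ha
    have k := hl a
    rw [ha.1, zero_smul, d0] at k
    generalize δ a = v at *
    obtain ⟨p', x', y', q', hp', hx', hy', hq', rfl⟩ := dec h he v
    rw [(cval hp' hx' hy' hq').1]
    simp only [mul_add, add_mul, hp'.1, hx'.1, hy'.1, hq'.1, one_smul, zero_smul, zero_mul,
      m21_22 h he hy ha] at k
    exact (ext4 (a := p') (x := x * a + x') (y := 0) (b := 0) hp' ((m12_22 h hx ha).add hx') P.zero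
      P.zero (by linear_combination (norm := abel) -k)).1

theorem cen11 (h : Alt R) {e : R} (he : e * e = e) {z : R} (hz : Cen z) : e * (z * e) = z * e := by
  rw [hz e, ← h.l, he]

theorem cenP (h : Alt R) {e : R} (he : e * e = e) {z : R} (hz : Cen z) : P e 1 1 (z * e) := by
  refine ⟨by rw [cen11 h he hz, one_smul], by rw [h.r, he, one_smul]⟩

theorem c22_add (e x y : R) : c22 e (x + y) = c22 e x + c22 e y := by
  simp only [c22, mul_add, add_mul]; abel

theorem c11_add (e x y : R) : c11 e (x + y) = c11 e x + c11 e y := by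
  simp only [c11, mul_add, add_mul]

theorem backward (h : Alt R) {e : R} (he : e * e = e) (e0 : e ≠ 0) (f0 : 1 - e ≠ 0)
    (h2 : ∀ x, P e 1 1 x → (∀ y, P e 1 0 y → x * y = 0) → x = 0)
    (h3 : ∀ x, P e 0 0 x → (∀ y, P e 0 1 y → x * y = 0) → x = 0)
    (h4 : ∀ z : R, Cen z → z ≠ 0 → ∀ y : R, ∃ x : R, z * x = y)
    {D : R → R} (hD : ∀ x y, D (br x y) = br (D x) y + br x (D y))
    (ca : ∀ a, P e 1 1 a → ∃ z, Cen z ∧ c22 e (D a) = z * (1 - e))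
    (cb : ∀ a, P e 0 0 a → ∃ z, Cen z ∧ c11 e (D a) = z * e) :
    ∃ δ : R → R, (∀ x y, δ (x + y) = δ x + δ y) ∧
    (∀ x y, δ (x * y) = δ x * y + x * δ y) ∧ ∀ x, Cen (D x - δ x) := by
  obtain ⟨Δ, dadd, dmul, hde⟩ : ∃ Δ : R → R, (∀ x y, Δ (x + y) = Δ x + Δ y) ∧
      (∀ x y, Δ (x * y) = Δ x * y + x * Δ y) ∧ br e (D e - Δ e) = 0 := by
    obtain ⟨a, x, y, b, ha, hx, hy, hb, hs⟩ := dec h he (D e)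
    refine ⟨Del e (-(x + y)), Del_add _ _, h.Del_mul _ _, ?_⟩
    have : Del e (-(x + y)) e = x + y := by
      have : As e (-(x + y)) e = 0 := sub_eq_zero.mpr (h.flex _ _)
      rw [Del, this]
      simp [mul_add, add_mul, sub_mul, mul_sub, he, hx.1, hx.2, hy.1, hy.2]
      abel
    rw [this, hs, br_sub]
    simp only [br_add]
    rw [br11 ha, br22 hb]; abel
  have dneg : ∀ x, Δ (-x) = - Δ x := by
    intro x
    have h0 : Δ 0 = 0 := by simpa using dadd 0 0
    have := dadd x (-x)
    rw [add_neg_cancel, h0] at this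
    linear_combination (norm := abel) -this
  have dbr : ∀ x y, Δ (br x y) = br (Δ x) y + br x (Δ y) := by
    intro x y
    rw [br, sub_eq_add_neg, dadd, dneg, dmul, dmul, br, br]; abel
  obtain ⟨hc22, hc11⟩ := der_comp h he dadd dmul
  obtain ⟨D', hD'⟩ : ∃ D' : R → R, ∀ x, D x = D' x + Δ x := ⟨fun x => D x - Δ x, fun x => by simp⟩
  have hl : ∀ x y, D' (br x y) = br (D' x) y + br x (D' y) := by
    intro x y
    have k := hD x y
    simp only [hD', dbr, add_br, br_add] at k
    linear_combination (norm := abel) k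
  have D0 : D' 0 = 0 := by simpa [br] using hl 0 0
  rw [hD', add_sub_cancel_right] at hde
  have cE : Cen (D' e) := by
    have := idem_key h he hl
    rwa [hde, br_zero, sub_zero] at this
  have hcom : ∀ w, br e w = 0 → br e (D' w) = 0 := by
    intro w hw
    have := hl e w
    rw [hw, D0, cE.br, zero_add] at this
    exact this.symm
  have cF : Cen (D' (1 - e)) := by
    have hf : (1 - e) * (1 - e) = 1 - e := by simp [mul_sub, sub_mul, he]
    have := idem_key h hf hl
    have k : br (1 - e) (D' (1 - e)) = 0 := by
      rw [sub_br, hcom (1 - e) (by simp [br, mul_sub, sub_mul])]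
      simp [br]
    rwa [k, br_zero, sub_zero] at this
  have dg : ∀ q, br e q = 0 → ∃ a b, P e 1 1 a ∧ P e 0 0 b ∧ q = a + b := by
    intro q hq
    obtain ⟨a', x', y', b', ha', hx', hy', hb', rfl⟩ := dec h he q
    simp only [br_add, br11 ha', br12 hx', br21 hy', br22 hb'] at hq
    obtain ⟨-, rx, ry, -⟩ := ext4 (a := 0) (x := x') (y := -y') (b := 0) P.zero hx'
      hy'.neg P.zero (by linear_combination (norm := abel) hq)
    exact ⟨a', b', ha', hb', by rw [rx, neg_eq_zero.mp ry]; abel⟩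
  have exA : ∀ a, ∃ v, P e 1 1 a → P e 1 1 v ∧ Cen (D' a - v) := by
    intro a
    by_cases ha : P e 1 1 a
    · obtain ⟨p, q, hp, hq, hpq⟩ := dg _ (hcom a (br11 ha))
      obtain ⟨z, hz, rz⟩ := ca a ha
      rw [hD', c22_add, hc22 a ha, add_zero, hpq] at rz
      have := (cval hp P.zero P.zero hq).2.2.2
      rw [add_zero, add_zero] at this
      rw [this] at rz
      refine ⟨p - z * e, fun _ => ⟨hp.sub (cenP h he hz), ?_⟩⟩
      rw [hpq, rz]
      convert hz using 1
      rw [mul_sub, mul_one]; abel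
    · exact ⟨0, fun h => absurd h ha⟩
  have exB : ∀ a, ∃ v, P e 0 0 a → P e 0 0 v ∧ Cen (D' a - v) := by
    intro a
    by_cases ha : P e 0 0 a
    · obtain ⟨p, q, hp, hq, hpq⟩ := dg _ (hcom a (br22 ha))
      obtain ⟨z, hz, rz⟩ := cb a ha
      rw [hD', c11_add, hc11 a ha, add_zero, hpq] at rz
      have := (cval hp P.zero P.zero hq).1
      rw [add_zero, add_zero] at this
      rw [this] at rz
      have hzf : P e 0 0 (z - z * e) := by
        refine ⟨?_, ?_⟩
        · rw [mul_sub, cen11 h he hz, hz e]; simp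
        · rw [sub_mul, h.r, he]; simp
      refine ⟨q - (z - z * e), fun _ => ⟨hq.sub hzf, ?_⟩⟩
      rw [hpq, rz]
      convert hz using 1
      abel
    · exact ⟨0, fun h => absurd h ha⟩
  choose A hA using exA
  choose B hB using exB
  have C : Ctx e D' A B := ⟨h, he, e0, f0, h2, h3, h4, hl, cE, cF, hA, hB⟩
  obtain ⟨δ, d1, d2, d3⟩ := C.main
  refine ⟨fun x => δ x + Δ x, ?_, ?_, ?_⟩
  · intro x y; simp only [d1, dadd]; abel
  · intro x y; simp only [d2, dmul, add_mul, mul_add]; abel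
  · intro x; have := d3 x
    rwa [show D' x - δ x = D x - (δ x + Δ x) by rw [hD']; abel] at this

end final
end LieAlt

/-- on a unital 2,3-torsion free alternative ring with a nontrivial
idempotent satisfying conditions (1)-(4), a multiplicative Lie derivation `D`
decomposes as `δ + τ` with `δ` an additive derivation and `τ` a central-valued
map killing commutators, iff `e₂ D(R₁₁) e₂ ⊆ Z(R) e₂` and `e₁ D(R₂₂) e₁ ⊆ Z(R) e₁`. -/
theorem stmt19 {R : Type*} [NonAssocRing R]
    (alt1 : ∀ x y : R, x * x * y = x * (x * y))
    (alt2 : ∀ x y : R, y * x * x = y * (x * x))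
    (tor2 : ∀ x : R, (2 : ℕ) • x = 0 → x = 0)
    (tor3 : ∀ x : R, (3 : ℕ) • x = 0 → x = 0)
    (e₁ : R) (he : e₁ * e₁ = e₁) (he0 : e₁ ≠ 0) (he1 : e₁ ≠ 1)
    (h1 : ∀ i j : Fin 2, i ≠ j → ∀ x ∈ peirceSet e₁ i j,
        (∀ y ∈ peirceSet e₁ j i, x * y = 0) → x = 0)
    (h2 : ∀ x ∈ peirceSet e₁ 0 0,
        ((∀ y ∈ peirceSet e₁ 0 1, x * y = 0) → x = 0) ∧
        ((∀ y ∈ peirceSet e₁ 1 0, y * x = 0) → x = 0))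
    (h3 : ∀ x ∈ peirceSet e₁ 1 1,
        ((∀ y ∈ peirceSet e₁ 0 1, y * x = 0) → x = 0) ∧
        ((∀ y ∈ peirceSet e₁ 1 0, x * y = 0) → x = 0))
    (h4 : ∀ z : R, (∀ r : R, z * r = r * z) → z ≠ 0 → ∀ y : R, ∃ x : R, z * x = y)
    (D : R → R)
    (hD : ∀ x y : R, D (x * y - y * x) =
        (D x * y - y * D x) + (x * D y - D y * x)) :
    (∃ δ τ : R → R,
        (∀ x y : R, δ (x + y) = δ x + δ y) ∧
        (∀ x y : R, δ (x * y) = δ x * y + x * δ y) ∧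
        (∀ x r : R, τ x * r = r * τ x) ∧
        (∀ x y : R, τ (x * y - y * x) = 0) ∧
        (∀ x : R, D x = δ x + τ x)) ↔
    ((∀ x ∈ peirceSet e₁ 0 0, ∃ z : R, (∀ r : R, z * r = r * z) ∧
        (1 - e₁) * (D x * (1 - e₁)) = z * (1 - e₁)) ∧
     (∀ x ∈ peirceSet e₁ 1 1, ∃ z : R, (∀ r : R, z * r = r * z) ∧
        e₁ * (D x * e₁) = z * e₁)) := by
  have h : LieAlt.Alt R := ⟨alt1, alt2, tor2, tor3⟩
  constructor
  · rintro ⟨δ, τ, dadd, dmul, tc, -, hsum⟩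
    obtain ⟨h22, h11⟩ := LieAlt.der_comp h he dadd dmul
    constructor
    · intro x hx
      rw [LieAlt.mem00 h he] at hx
      refine ⟨τ x, tc x, ?_⟩
      rw [LieAlt.c22_eq, hsum, LieAlt.c22_add, h22 x hx, zero_add, LieAlt.c22,
        LieAlt.cen11 h he (tc x), mul_sub, mul_one, ← tc x e₁]
      abel
    · intro x hx
      rw [LieAlt.mem11 h he] at hx
      refine ⟨τ x, tc x, ?_⟩
      have := LieAlt.c11_add e₁ (δ x) (τ x)
      rw [h11 x hx, zero_add, LieAlt.c11, LieAlt.c11, LieAlt.cen11 h he (tc x)] at this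
      rw [hsum, this]
  · rintro ⟨ca, cb⟩
    have hD' : ∀ x y, D (LieAlt.br x y) = LieAlt.br (D x) y + LieAlt.br x (D y) := hD
    obtain ⟨δ, d1, d2, d3⟩ := LieAlt.backward h he he0 (sub_ne_zero.mpr he1.symm)
      (fun x hx hy => (h2 x ((LieAlt.mem00 h he).mpr hx)).1
        (fun y hy' => hy y ((LieAlt.mem01 h he).mp hy')))
      (fun x hx hy => (h3 x ((LieAlt.mem11 h he).mpr hx)).2
        (fun y hy' => hy y ((LieAlt.mem10 h he).mp hy')))
      h4 hD'
      (fun a ha => by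
        obtain ⟨z, hz, rz⟩ := ca a ((LieAlt.mem00 h he).mpr ha)
        exact ⟨z, hz, by rw [← LieAlt.c22_eq]; exact rz⟩)
      (fun a ha => by
        obtain ⟨z, hz, rz⟩ := cb a ((LieAlt.mem11 h he).mpr ha)
        exact ⟨z, hz, rz⟩)
    refine ⟨δ, fun x => D x - δ x, d1, d2, fun x => d3 x, ?_, fun x => by simp⟩
    intro x y
    have dneg : ∀ x, δ (-x) = - δ x := by
      intro x
      have h0 : δ 0 = 0 := by simpa using d1 0 0
      have := d1 x (-x)
      rw [add_neg_cancel, h0] at this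
      linear_combination (norm := abel) -this
    have c1 := d3 x y
    have c2 := d3 y x
    simp only [sub_mul, mul_sub] at c1 c2
    change D (x * y - y * x) - δ (x * y - y * x) = 0
    rw [hD, sub_eq_add_neg (x * y), d1, dneg, d2, d2]
    linear_combination (norm := abel) c1 - c2
end
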